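/- Under the a priori hypotheses, if m > 2/T and 2/m < ε < T, then there exists C₄ > 0 depending only on Ω, m, ε, T, C_f and the constants C₁, C₂, C₃ (the uniform bound on |u|, the bound from t|∂u/∂t| ≤ C₂, and the boundary gradient bound), hence only on Ω, m, ε, T, C_u, C_φ, C_f, such that |∇u| ≤ C₄ on Ω×(ε,T). -/

import Mathlib

open Set Metric Complex Topology Filter Bornology
open scoped ComplexOrder

noncomputable section

/-- `ℂⁿ` with its Euclidean structure. -/
abbrev Cn (n : ℕ) := EuclideanSpace ℂ (Fin n)

/-- The `α`-th coordinate vector scaled by `c`. -/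
def cvec (n : ℕ) (α : Fin n) (c : ℂ) : Cn n := EuclideanSpace.single α c

variable {n : ℕ}

/-- Wirtinger derivative `∂/∂z_α` (within a set), via the real Fréchet derivative. -/
def wderW (s : Set (Cn n)) (α : Fin n) (u : Cn n → ℂ) (z : Cn n) : ℂ :=
  (fderivWithin ℝ u s z (cvec n α 1) - Complex.I * fderivWithin ℝ u s z (cvec n α Complex.I)) / 2

/-- Conjugate Wirtinger derivative `∂/∂z̄_β` (within a set). -/
def wderBarW (s : Set (Cn n)) (β : Fin n) (u : Cn n → ℂ) (z : Cn n) : ℂ :=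
  (fderivWithin ℝ u s z (cvec n β 1) + Complex.I * fderivWithin ℝ u s z (cvec n β Complex.I)) / 2

/-- The complex Hessian matrix `u_{αβ̄} = ∂²u/∂z_α ∂z̄_β` of a real valued function,
computed within a set `s`. -/
def cHessW (s : Set (Cn n)) (u : Cn n → ℝ) (z : Cn n) : Matrix (Fin n) (Fin n) ℂ :=
  Matrix.of fun α β => wderW s α (wderBarW s β fun w => (u w : ℂ)) z

/-- The complex Hessian matrix `u_{αβ̄}`. -/
def cHess (u : Cn n → ℝ) : Cn n → Matrix (Fin n) (Fin n) ℂ := cHessW univ u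

/-- The Euclidean Laplacian (within a set) of `v : ℂⁿ → ℝ`, i.e. the sum of all pure second
derivatives in the `2n` underlying real coordinate directions. -/
def lapW (s : Set (Cn n)) (v : Cn n → ℝ) (z : Cn n) : ℝ :=
  ∑ α : Fin n,
    (fderivWithin ℝ (fun y => fderivWithin ℝ v s y (cvec n α 1)) s z (cvec n α 1) +
      fderivWithin ℝ (fun y => fderivWithin ℝ v s y (cvec n α Complex.I)) s z
        (cvec n α Complex.I))

/-- The Euclidean Laplacian of `v : ℂⁿ → ℝ`. -/
def lap (v : Cn n → ℝ) : Cn n → ℝ := lapW univ v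

/-- A bounded smooth strictly pseudoconvex domain of `ℂⁿ`: a bounded (nonempty) domain with a
smooth strictly plurisubharmonic defining function `ρ` on a bounded neighbourhood of its closure,
with nonvanishing differential on the boundary. -/
def IsSPCDomain (Ω : Set (Cn n)) : Prop :=
  IsOpen Ω ∧ Ω.Nonempty ∧ IsBounded Ω ∧
    ∃ (U : Set (Cn n)) (ρ : Cn n → ℝ), IsOpen U ∧ IsBounded U ∧ closure Ω ⊆ U ∧
      ContDiffOn ℝ (⊤ : ℕ∞) ρ U ∧ (∀ z ∈ U, (cHess ρ z).PosDef) ∧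
      Ω = {z ∈ U | ρ z < 0} ∧ ∀ z ∈ frontier Ω, fderiv ℝ ρ z ≠ 0

/-- Membership in `C^{2;1}(Ω̄ × [0,T))`: `u(·,t) ∈ C²(Ω̄)` for each `t ∈ [0,T)`,
`u(z,·) ∈ C¹([0,T))` for each `z ∈ Ω̄`, and `∂u/∂t` together with all second spatial
derivatives are continuous on `Ω̄ × [0,T)`. -/
def C21 (n : ℕ) (Ω : Set (Cn n)) (T : ℝ) (u : Cn n × ℝ → ℝ) : Prop :=
  (∀ t ∈ Ico (0 : ℝ) T, ContDiffOn ℝ 2 (fun z => u (z, t)) (closure Ω)) ∧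
  (∀ z ∈ closure Ω, ContDiffOn ℝ 1 (fun s => u (z, s)) (Ico (0 : ℝ) T)) ∧
  ContinuousOn (fun p : Cn n × ℝ => derivWithin (fun s => u (p.1, s)) (Ico (0 : ℝ) T) p.2)
    (closure Ω ×ˢ Ico (0 : ℝ) T) ∧
  ∀ v w : Cn n, ContinuousOn
    (fun p : Cn n × ℝ =>
      fderivWithin ℝ (fun y => fderivWithin ℝ (fun x => u (x, p.2)) (closure Ω) y v)
        (closure Ω) p.1 w)
    (closure Ω ×ˢ Ico (0 : ℝ) T)

/-- The hypotheses of the a priori estimates theorem: `φ ∈ C^∞(Ω̄×[0,T))`,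
`f ∈ C^∞([0,T)×Ω̄×ℝ)`, `u ∈ C^∞(Ω×(0,T)) ∩ C^{2;1}(Ω̄×[0,T))` is strictly plurisubharmonic
in `z` and solves `∂u/∂t = log det(u_{αβ̄}) + f(t,z,u)` on `Ω×(0,T)` with `u = φ` on
`∂Ω×[0,T)`, `sup_Ω |u(·,0)| ≤ Cu`, `f` nonincreasing in the last variable,
`‖f‖_{C²((0,T)×Ω×ℝ)} ≤ Cf` and `‖φ‖_{C⁴(Ω×(0,T))} ≤ Cφv` (parabolic norm). -/
def AprioriHyps (n : ℕ) (Ω : Set (Cn n)) (T Cu Cφv Cf : ℝ)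
    (u φ : Cn n × ℝ → ℝ) (f : ℝ × Cn n × ℝ → ℝ) : Prop :=
  ContDiffOn ℝ (⊤ : ℕ∞) φ (closure Ω ×ˢ Ico (0 : ℝ) T) ∧
  ContDiffOn ℝ (⊤ : ℕ∞) f (Ico (0 : ℝ) T ×ˢ closure Ω ×ˢ (univ : Set ℝ)) ∧
  ContDiffOn ℝ (⊤ : ℕ∞) u (Ω ×ˢ Ioo (0 : ℝ) T) ∧
  C21 n Ω T u ∧
  (∀ t ∈ Ioo (0 : ℝ) T, ∀ z ∈ Ω, (cHess (fun w => u (w, t)) z).PosDef) ∧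
  (∀ z ∈ Ω, ∀ t ∈ Ioo (0 : ℝ) T,
    deriv (fun s => u (z, s)) t
      = Real.log ((cHess (fun w => u (w, t)) z).det.re) + f (t, z, u (z, t))) ∧
  (∀ z ∈ frontier Ω, ∀ t ∈ Ico (0 : ℝ) T, u (z, t) = φ (z, t)) ∧
  (∀ z ∈ Ω, |u (z, 0)| ≤ Cu) ∧
  (∀ t ∈ Ioo (0 : ℝ) T, ∀ z ∈ Ω, ∀ r : ℝ, deriv (fun y => f (t, z, y)) r ≤ 0) ∧
  (∀ k : ℕ, k ≤ 2 → ∀ p ∈ Ioo (0 : ℝ) T ×ˢ Ω ×ˢ (univ : Set ℝ),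
    ‖iteratedFDeriv ℝ k f p‖ ≤ Cf) ∧
  (∀ j l : ℕ, j + 2 * l ≤ 4 → ∀ z ∈ Ω, ∀ t ∈ Ioo (0 : ℝ) T,
    ‖iteratedFDeriv ℝ j (fun w => iteratedDeriv l (fun s => φ (w, s)) t) z‖ ≤ Cφv)



/-! ### Linear algebra -/

lemma posDef_det_re_pos {K : Matrix (Fin n) (Fin n) ℂ} (hK : K.PosDef) : 0 < K.det.re := by
  have := hK.det_pos
  exact (RCLike.pos_iff.mp this).1

lemma posDef_det_im {K : Matrix (Fin n) (Fin n) ℂ} (hK : K.PosDef) : K.det.im = 0 := by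
  have := hK.det_pos
  exact (RCLike.pos_iff.mp this).2

lemma det_re_eq_prod {K : Matrix (Fin n) (Fin n) ℂ} (hK : K.PosDef) :
    K.det.re = ∏ i, hK.1.eigenvalues i := by
  rw [hK.1.det_eq_prod_eigenvalues]
  rw [← Complex.ofReal_re (∏ i, hK.1.eigenvalues i)]
  push_cast
  rfl

lemma log_det_le_trace {K : Matrix (Fin n) (Fin n) ℂ} (hK : K.PosDef) :
    Real.log K.det.re ≤ K.trace.re - n := by
  rw [det_re_eq_prod hK, hK.1.trace_eq_sum_eigenvalues,
    Real.log_prod (fun i _ => (hK.eigenvalues_pos i).ne')]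
  have h : ∀ i, Real.log (hK.1.eigenvalues i) ≤ hK.1.eigenvalues i - 1 := fun i =>
    Real.log_le_sub_one_of_pos (hK.eigenvalues_pos i)
  refine (Finset.sum_le_sum fun i _ => h i).trans ?_
  simp

/-- the quadratic form of a matrix -/
def qf (K : Matrix (Fin n) (Fin n) ℂ) (x : Cn n) : ℝ := (star (⇑x) ⬝ᵥ (K.mulVec ⇑x)).re

lemma qf_eigen {H : Matrix (Fin n) (Fin n) ℂ} (hH : H.PosDef) (i : Fin n) :
    qf H (hH.1.eigenvectorBasis i) = hH.1.eigenvalues i := by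
  unfold qf
  have := hH.1.eigenvalues_eq i
  rw [this]; rfl

lemma qf_pos {H : Matrix (Fin n) (Fin n) ℂ} (hH : H.PosDef) {x : Cn n} (hx : x ≠ 0) :
    0 < qf H x := by
  refine hH.re_dotProduct_pos (x := ⇑x) ?_
  intro h
  apply hx
  ext i
  exact congrFun h i

lemma log_det_concave {H K : Matrix (Fin n) (Fin n) ℂ} (hH : H.PosDef) (hK : K.PosDef) :
    Real.log K.det.re ≤ Real.log H.det.re +
      ∑ i, (qf K (hH.1.eigenvectorBasis i) / hH.1.eigenvalues i - 1) := by
  set l := hH.1.eigenvalues with hl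
  have lpos : ∀ i, 0 < l i := hH.eigenvalues_pos
  set U : Matrix (Fin n) (Fin n) ℂ := hH.1.eigenvectorUnitary.1 with hU
  have hUU : star U * U = 1 := by simp [hU]
  set D : Matrix (Fin n) (Fin n) ℂ := Matrix.diagonal fun i => (((Real.sqrt (l i))⁻¹ : ℝ) : ℂ) with hD
  have hdet : D.det * D.det * H.det = 1 := by
    rw [hH.1.det_eq_prod_eigenvalues, hD, Matrix.det_diagonal, ← Finset.prod_mul_distrib,
      ← Finset.prod_mul_distrib]
    apply Finset.prod_eq_one
    intro i _
    have h1 : (Real.sqrt (l i))⁻¹ * (Real.sqrt (l i))⁻¹ * l i = 1 := by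
      have := Real.mul_self_sqrt (lpos i).le
      have h0 := Real.sqrt_pos.2 (lpos i)
      field_simp
      nlinarith
    have := congrArg (fun r : ℝ => (r : ℂ)) h1
    simpa [hl] using this
  have hUdet : star U.det * U.det = 1 := by
    have := congrArg Matrix.det hUU
    rw [Matrix.det_mul, Matrix.star_eq_conjTranspose, Matrix.det_conjTranspose, Matrix.det_one] at this
    exact this
  have hDstar : D.conjTranspose = D := by
    rw [hD, Matrix.diagonal_conjTranspose]
    congr 1
    ext i
    simp
  have hVdet : IsUnit (U * D).det := by
    rw [Matrix.det_mul, isUnit_iff_ne_zero]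
    refine mul_ne_zero ?_ ?_
    · intro h; rw [h] at hUdet; simp at hUdet
    · intro h; rw [h] at hdet; simp at hdet
  have hM : ((U * D).conjTranspose * K * (U * D)).PosDef := by
    refine hK.conjTranspose_mul_mul_same ?_
    exact Matrix.mulVec_injective_of_isUnit ((Matrix.isUnit_iff_isUnit_det _).2 hVdet)
  have hdetM : ((U * D).conjTranspose * K * (U * D)).det * H.det = K.det := by
    simp only [Matrix.det_mul, Matrix.det_conjTranspose]
    have : star D.det = D.det := by rw [← Matrix.det_conjTranspose, hDstar]
    rw [star_mul, this]
    calc _ = (star U.det * U.det) * (D.det * D.det * H.det) * K.det := by ring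
      _ = _ := by rw [hUdet, hdet]; ring
  have htr : ((U * D).conjTranspose * K * (U * D)).trace.re =
      ∑ i, qf K (hH.1.eigenvectorBasis i) / l i := by
    rw [Matrix.trace, Complex.re_sum]
    refine Finset.sum_congr rfl fun i _ => ?_
    have e : ((U * D).conjTranspose * K * (U * D)) i i =
        (((Real.sqrt (l i))⁻¹ : ℝ) : ℂ) * (((Real.sqrt (l i))⁻¹ : ℝ) : ℂ) * (star (⇑(hH.1.eigenvectorBasis i)) ⬝ᵥ (K.mulVec ⇑(hH.1.eigenvectorBasis i))) := by
      rw [Matrix.conjTranspose_mul, hDstar, hD]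
      rw [Matrix.mul_assoc, Matrix.mul_assoc, Matrix.diagonal_mul, ← Matrix.mul_assoc, ← Matrix.mul_assoc, Matrix.mul_diagonal]
      have : (U.conjTranspose * K * U) i i = star (⇑(hH.1.eigenvectorBasis i)) ⬝ᵥ (K.mulVec ⇑(hH.1.eigenvectorBasis i)) := by
        rw [Matrix.mul_assoc, Matrix.mul_apply']
        congr 1
      rw [this]; ring
    rw [Matrix.diag_apply, e, ← Complex.ofReal_mul, Complex.re_ofReal_mul]
    unfold qf
    have := Real.mul_self_sqrt (lpos i).le
    have h0 := Real.sqrt_pos.2 (lpos i)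
    rw [← mul_inv, this]
    field_simp
  have h1 := log_det_le_trace hM
  have h2 : K.det.re = ((U * D).conjTranspose * K * (U * D)).det.re * H.det.re := by
    rw [← hdetM, Complex.mul_re, posDef_det_im hH]; ring
  rw [h2, Real.log_mul (posDef_det_re_pos hM).ne' (posDef_det_re_pos hH).ne', Finset.sum_sub_distrib, ← htr]
  simp only [Finset.sum_const, Finset.card_univ, Fintype.card_fin, nsmul_eq_mul, mul_one]
  linarith

lemma log_det_mono {H K : Matrix (Fin n) (Fin n) ℂ} (hH : H.PosDef) (hK : K.PosDef)
    (h : ∀ x, qf K x ≤ qf H x) : Real.log K.det.re ≤ Real.log H.det.re := by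
  refine (log_det_concave hH hK).trans ?_
  have : ∑ i, (qf K (hH.1.eigenvectorBasis i) / hH.1.eigenvalues i - 1) ≤ 0 := by
    apply Finset.sum_nonpos
    intro i _
    have h1 := h (hH.1.eigenvectorBasis i)
    rw [qf_eigen hH i] at h1
    have := (div_le_one (hH.eigenvalues_pos i)).2 h1
    linarith
  linarith

lemma log_det_ge {H : Matrix (Fin n) (Fin n) ℂ} (hH : H.PosDef) {c : ℝ} (hc : 0 < c)
    (h : ∀ x, c * ‖x‖ ^ 2 ≤ qf H x) : n * Real.log c ≤ Real.log H.det.re := by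
  rw [det_re_eq_prod hH, Real.log_prod (fun i _ => (hH.eigenvalues_pos i).ne')]
  have : ∀ i ∈ Finset.univ, Real.log c ≤ Real.log (hH.1.eigenvalues i) := by
    intro i _
    apply Real.log_le_log hc
    have h1 := h (hH.1.eigenvectorBasis i)
    rw [qf_eigen hH i] at h1
    simpa using h1
  have := Finset.card_nsmul_le_sum _ _ _ this
  simpa using this


/-! ### Calculus -/

/-- second derivative -/
def D2 (g : Cn n → ℝ) (z v w : Cn n) : ℝ := fderiv ℝ (fderiv ℝ g) z v w

/-- the (unnormalised) Levi form -/
def lv (g : Cn n → ℝ) (z v : Cn n) : ℝ := D2 g z v v + D2 g z (Complex.I • v) (Complex.I • v)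

/-- a twice differentiable germ at zero -/
def Tw (p p1 : ℝ → ℝ) (p2 : ℝ) : Prop :=
  (∀ᶠ s in 𝓝 (0 : ℝ), HasDerivAt p (p1 s) s) ∧ HasDerivAt p1 p2 0

lemma Tw.le {p p1 : ℝ → ℝ} {p2 : ℝ} (h : Tw p p1 p2) (hm : IsLocalMax p 0) : p2 ≤ 0 := by
  by_contra! hp
  obtain ⟨h1, h2⟩ := h
  have e1 : deriv p =ᶠ[𝓝 0] p1 := h1.mono fun s hs => hs.deriv
  have e2 : deriv (deriv p) 0 = p2 := by rw [e1.deriv_eq, h2.deriv]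
  have h0 : deriv p 0 = 0 := hm.deriv_eq_zero
  have hmin := isLocalMin_of_deriv_deriv_pos (f := p) (x₀ := 0) (by rw [e2]; exact hp) h0
    h1.self_of_nhds.continuousAt
  have hc : p =ᶠ[𝓝 0] fun _ => p 0 := by
    filter_upwards [hm, hmin] with s a b using le_antisymm a b
  have : deriv (deriv p) 0 = 0 := by
    have : deriv p =ᶠ[𝓝 0] fun _ => 0 := by
      have := hc.deriv
      simpa using this
    rw [this.deriv_eq]; simp
  linarith

lemma Tw.add {p p1 q q1 : ℝ → ℝ} {p2 q2 : ℝ} (h : Tw p p1 p2) (h' : Tw q q1 q2) :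
    Tw (fun s => p s + q s) (fun s => p1 s + q1 s) (p2 + q2) :=
  ⟨by filter_upwards [h.1, h'.1] with s a b using a.add b, h.2.add h'.2⟩

lemma Tw.sub {p p1 q q1 : ℝ → ℝ} {p2 q2 : ℝ} (h : Tw p p1 p2) (h' : Tw q q1 q2) :
    Tw (fun s => p s - q s) (fun s => p1 s - q1 s) (p2 - q2) :=
  ⟨by filter_upwards [h.1, h'.1] with s a b using a.sub b, h.2.sub h'.2⟩

lemma Tw.const_mul {p p1 : ℝ → ℝ} {p2 : ℝ} (c : ℝ) (h : Tw p p1 p2) :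
    Tw (fun s => c * p s) (fun s => c * p1 s) (c * p2) :=
  ⟨by filter_upwards [h.1] with s a using a.const_mul c, h.2.const_mul c⟩

lemma Tw.const (c : ℝ) : Tw (fun _ => c) (fun _ => 0) 0 :=
  ⟨Eventually.of_forall fun s => hasDerivAt_const s c, hasDerivAt_const 0 _⟩

lemma Tw.sq {p p1 : ℝ → ℝ} {p2 : ℝ} (h : Tw p p1 p2) :
    Tw (fun s => p s ^ 2) (fun s => 2 * p s * p1 s) (2 * (p1 0) ^ 2 + 2 * p 0 * p2) := by
  refine ⟨?_, ?_⟩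
  · filter_upwards [h.1] with s a
    simpa using a.fun_pow 2
  · have := (h.1.self_of_nhds.const_mul 2).fun_mul h.2
    exact this.congr_deriv (by ring)

lemma Tw.line {g : Cn n → ℝ} {z : Cn n} (hg : ContDiffAt ℝ 2 g z) (v : Cn n) :
    Tw (fun s : ℝ => g (z + s • v)) (fun s => fderiv ℝ g (z + s • v) v) (D2 g z v v) := by
  have hl : ∀ s : ℝ, HasDerivAt (fun s : ℝ => z + s • v) v s := fun s => by
    simpa using ((hasDerivAt_id s).smul_const v).const_add z
  have hl0 : Tendsto (fun s : ℝ => z + s • v) (𝓝 0) (𝓝 z) := by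
    have := (hl 0).continuousAt.tendsto
    simpa using this
  refine ⟨?_, ?_⟩
  · have : ∀ᶠ y in 𝓝 z, DifferentiableAt ℝ g y := by
      have := hg.eventually (by simp)
      filter_upwards [this] with y hy using hy.differentiableAt (by simp)
    filter_upwards [hl0.eventually this] with s hs
    exact hs.hasFDerivAt.comp_hasDerivAt s (hl s)
  · have h1 : DifferentiableAt ℝ (fderiv ℝ g) z :=
      (hg.fderiv_right (m := 1) (by norm_num)).differentiableAt (by simp)
    have h2 : HasFDerivAt (fderiv ℝ g) (fderiv ℝ (fderiv ℝ g) z) (z + (0 : ℝ) • v) := by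
      simpa using h1.hasFDerivAt
    have h3 := h2.comp_hasDerivAt (0 : ℝ) (hl 0)
    exact (ContinuousLinearMap.apply ℝ ℝ v).hasFDerivAt.comp_hasDerivAt 0 h3

lemma Tw.normSq (z v : Cn n) :
    Tw (fun s : ℝ => ‖z + s • v‖ ^ 2) (fun s => 2 * inner ℝ z v + 2 * s * ‖v‖ ^ 2)
      (2 * ‖v‖ ^ 2) := by
  have e : (fun s : ℝ => ‖z + s • v‖ ^ 2) = fun s => ‖z‖ ^ 2 + 2 * s * inner ℝ z v + s ^ 2 * ‖v‖ ^ 2 := by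
    ext s
    rw [norm_add_sq_real, inner_smul_right, norm_smul, mul_pow, Real.norm_eq_abs, sq_abs]
    ring
  rw [e]
  refine ⟨Eventually.of_forall fun s => ?_, ?_⟩
  · have h1 : HasDerivAt (fun s : ℝ => 2 * s * inner ℝ z v) (2 * inner ℝ z v) s := by
      simpa using ((hasDerivAt_id s).const_mul 2).mul_const (inner ℝ z v)
    have h2 : HasDerivAt (fun s : ℝ => s ^ 2 * ‖v‖ ^ 2) (2 * s * ‖v‖ ^ 2) s := by
      simpa using ((hasDerivAt_id s).fun_pow 2).mul_const (‖v‖ ^ 2)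
    exact (h1.const_add (‖z‖ ^ 2)).add h2
  · have h1 : HasDerivAt (fun s : ℝ => 2 * s * ‖v‖ ^ 2) (2 * ‖v‖ ^ 2) 0 := by
      simpa using ((hasDerivAt_id (0:ℝ)).const_mul 2).mul_const (‖v‖ ^ 2)
    exact h1.const_add _

lemma time_test {p : ℝ → ℝ} {p' t a : ℝ} (h : HasDerivAt p p' t) (hat : a < t)
    (hm : ∀ s ∈ Icc a t, p s ≤ p t) : 0 ≤ p' := by
  have h1 : HasDerivWithinAt p p' (Iio t) t := h.hasDerivWithinAt
  rw [hasDerivWithinAt_iff_tendsto_slope' (by simp)] at h1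
  refine ge_of_tendsto h1 ?_
  have : Ioo a t ∈ 𝓝[<] t := Ioo_mem_nhdsLT hat
  filter_upwards [this] with s hs
  rw [slope_def_field]
  have := hm s ⟨hs.1.le, hs.2.le⟩
  apply div_nonneg_of_nonpos <;> linarith [hs.2]

lemma cHess_apply {g : Cn n → ℝ} {z : Cn n} (hg : ContDiffAt ℝ 2 g z) (α β : Fin n) :
    cHess g z α β = ((D2 g z (cvec n α 1) (cvec n β 1) + D2 g z (cvec n α I) (cvec n β I) : ℝ)
      + I * (D2 g z (cvec n α 1) (cvec n β I) - D2 g z (cvec n α I) (cvec n β 1) : ℝ)) / 4 := by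
  have h1 : DifferentiableAt ℝ (fderiv ℝ g) z :=
    (hg.fderiv_right (m := 1) (by norm_num)).differentiableAt (by simp)
  have hev : ∀ᶠ y in 𝓝 z, DifferentiableAt ℝ g y := by
    have := hg.eventually (by simp)
    filter_upwards [this] with y hy using hy.differentiableAt (by simp)
  have hw : wderBarW univ β (fun w => (g w : ℂ)) =ᶠ[𝓝 z]
      fun y => ((fderiv ℝ g y (cvec n β 1) : ℂ) + I * (fderiv ℝ g y (cvec n β I) : ℂ)) / 2 := by
    filter_upwards [hev] with y hy
    unfold wderBarW
    have : HasFDerivAt (fun w => (g w : ℂ)) (Complex.ofRealCLM.comp (fderiv ℝ g y)) y :=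
      Complex.ofRealCLM.hasFDerivAt.comp y hy.hasFDerivAt
    rw [fderivWithin_univ, this.fderiv]
    simp
  have hd : HasFDerivAt (fun y => ((fderiv ℝ g y (cvec n β 1) : ℂ) + I * (fderiv ℝ g y (cvec n β I) : ℂ)) / 2)
      ((2:ℂ)⁻¹ • (Complex.ofRealCLM.comp ((fderiv ℝ (fderiv ℝ g) z).flip (cvec n β 1)) +
        I • (Complex.ofRealCLM.comp ((fderiv ℝ (fderiv ℝ g) z).flip (cvec n β I))))) z := by
    have a : ∀ v, HasFDerivAt (fun y => (fderiv ℝ g y v : ℂ))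
        (Complex.ofRealCLM.comp ((fderiv ℝ (fderiv ℝ g) z).flip v)) z := fun v => by
      have : HasFDerivAt (fun y => fderiv ℝ g y v) ((fderiv ℝ (fderiv ℝ g) z).flip v) z :=
        (ContinuousLinearMap.apply ℝ ℝ v).hasFDerivAt.comp z h1.hasFDerivAt
      exact Complex.ofRealCLM.hasFDerivAt.comp z this
    have := ((a (cvec n β 1)).add ((a (cvec n β I)).const_mul I)).const_mul (2:ℂ)⁻¹
    refine this.congr_of_eventuallyEq (Eventually.of_forall fun y => ?_)
    simp only [Pi.add_apply]
    ring
  unfold cHess cHessW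
  rw [Matrix.of_apply]
  unfold wderW
  rw [fderivWithin_univ, hw.fderiv_eq, hd.fderiv]
  simp [D2]
  ring_nf
  simp
  ring

lemma qf_cHess {g : Cn n → ℝ} {z : Cn n} (hg : ContDiffAt ℝ 2 g z) (x : Cn n) :
    qf (cHess g z).transpose x = lv g z x / 4 := by
  set B : Cn n → Cn n → ℂ := fun v w => ((D2 g z v w + D2 g z (I • v) (I • w) : ℝ)
      + I * (D2 g z v (I • w) - D2 g z (I • v) w : ℝ)) / 4 with hB
  have D2add1 : ∀ a b c, D2 g z (a + b) c = D2 g z a c + D2 g z b c := by intros; simp [D2]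
  have D2add2 : ∀ a b c, D2 g z c (a + b) = D2 g z c a + D2 g z c b := by intros; simp [D2]
  have D2s1 : ∀ (r : ℝ) a b, D2 g z (r • a) b = r * D2 g z a b := by intros; simp [D2]
  have D2s2 : ∀ (r : ℝ) a b, D2 g z a (r • b) = r * D2 g z a b := by intros; simp [D2]
  have cs : ∀ (c : ℂ) (v : Cn n), c • v = c.re • v + c.im • (I • v) := by
    intro c v
    ext i
    simp only [PiLp.smul_apply, PiLp.add_apply, smul_eq_mul, Complex.real_smul]
    conv_lhs => rw [← Complex.re_add_im c]
    ring
  have II : ∀ v : Cn n, I • (I • v) = (-1 : ℝ) • v := by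
    intro v; rw [smul_smul, I_mul_I]; simp
  have Ir : ∀ (r : ℝ) (v : Cn n), I • (r • v) = r • (I • v) := fun r v => smul_comm _ _ _
  have B1 : ∀ a b c, B (a + b) c = B a c + B b c := by
    intro a b c
    simp only [hB, smul_add, D2add1]; push_cast; ring
  have B2 : ∀ a b c, B c (a + b) = B c a + B c b := by
    intro a b c
    simp only [hB, smul_add, D2add2]; push_cast; ring
  have B3 : ∀ (c : ℂ) a b, B (c • a) b = c * B a b := by
    intro c a b
    rw [cs c a]
    simp only [hB, smul_add, D2add1, D2s1, Ir, II]
    push_cast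
    conv_rhs => rw [← Complex.re_add_im c]
    linear_combination (c.im * (D2 g z a (I • b) - D2 g z (I • a) b) : ℂ) / (-4) * I_sq
  have B4 : ∀ (c : ℂ) a b, B a (c • b) = (starRingEnd ℂ) c * B a b := by
    intro c a b
    rw [cs c b]
    simp only [hB, smul_add, D2add2, D2s2, Ir, II]
    push_cast
    have : (starRingEnd ℂ) c = c.re - c.im * I := by
      apply Complex.ext <;> simp
    rw [this]
    linear_combination (c.im * (D2 g z a (I • b) - D2 g z (I • a) b) : ℂ) / 4 * I_sq
  have Bs1 : ∀ (s : Finset (Fin n)) (a : Fin n → Cn n) c, B (∑ i ∈ s, a i) c = ∑ i ∈ s, B (a i) c := by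
    intro s a c
    exact map_sum (AddMonoidHom.mk' (fun v => B v c) (fun a b => B1 a b c)) a s
  have Bs2 : ∀ (s : Finset (Fin n)) (a : Fin n → Cn n) c, B c (∑ i ∈ s, a i) = ∑ i ∈ s, B c (a i) := by
    intro s a c
    exact map_sum (AddMonoidHom.mk' (fun v => B c v) (fun a b => B2 a b c)) a s
  have hcI : ∀ α, cvec n α I = I • cvec n α 1 := by
    intro α; ext i; simp [cvec]
  have hx : x = ∑ i, x i • cvec n i 1 := by
    ext j
    simp [cvec, Pi.single_apply]
  have hBe : ∀ α β, cHess g z α β = B (cvec n α 1) (cvec n β 1) := by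
    intro α β
    rw [cHess_apply hg, hcI, hcI]
  have key : star (⇑x) ⬝ᵥ ((cHess g z).transpose.mulVec ⇑x) = B x x := by
    conv_rhs => rw [hx]
    rw [Bs2]
    simp only [Bs1, B3, B4, dotProduct, Matrix.mulVec, Matrix.transpose_apply, hBe, Finset.mul_sum]
    refine Finset.sum_congr rfl fun i _ => Finset.sum_congr rfl fun j _ => ?_
    simp
    ring
  unfold qf
  rw [key]
  simp only [hB, lv]
  rw [show (4:ℂ) = ((4:ℝ):ℂ) by norm_num, Complex.div_ofReal_re]
  simp


/-! ### The domain -/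

/-- Lipschitz estimate for functions with bounded gradient on a subset of `Ω`. -/
def LipNear (Ω s : Set (Cn n)) (K : ℝ) : Prop :=
  ∀ (g : Cn n → ℝ) (C : ℝ), 0 ≤ C → (∀ z ∈ Ω, DifferentiableAt ℝ g z) →
    (∀ z ∈ Ω, ‖fderiv ℝ g z‖ ≤ C) → ∀ x ∈ Ω ∩ s, ∀ y ∈ Ω ∩ s, |g x - g y| ≤ K * C * ‖x - y‖

lemma seg_lip {Ω : Set (Cn n)} {g : Cn n → ℝ} {C : ℝ} (hd : ∀ z ∈ Ω, DifferentiableAt ℝ g z)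
    (hb : ∀ z ∈ Ω, ‖fderiv ℝ g z‖ ≤ C) {x y : Cn n} (h : segment ℝ x y ⊆ Ω) :
    |g x - g y| ≤ C * ‖x - y‖ := by
  have := (convex_segment x y).norm_image_sub_le_of_norm_fderiv_le (𝕜 := ℝ) (f := g) (C := C)
    (fun z hz => hd z (h hz)) (fun z hz => hb z (h hz)) (right_mem_segment ℝ x y) (left_mem_segment ℝ x y)
  simpa using this

lemma lipNear_interior {Ω : Set (Cn n)} (hΩ : IsOpen Ω) {p : Cn n} (hp : p ∈ Ω) :
    ∃ r > 0, ∃ K, LipNear Ω (ball p r) K := by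
  obtain ⟨r, hr, hb⟩ := Metric.isOpen_iff.1 hΩ p hp
  refine ⟨r, hr, 1, ?_⟩
  intro g C hC hd hbd x hx y hy
  rw [one_mul]
  exact seg_lip hd hbd (((convex_ball p r).segment_subset hx.2 hy.2).trans hb)

lemma lipNear_boundary {Ω U : Set (Cn n)} {ρ : Cn n → ℝ} (hU : IsOpen U)
    (hΩU : Ω = {z ∈ U | ρ z < 0}) {p : Cn n} (hpU : p ∈ U) (hρ : ContDiffAt ℝ 1 ρ p)
    (hne : fderiv ℝ ρ p ≠ 0) :
    ∃ r > 0, ∃ K, LipNear Ω (ball p r) K := by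
  obtain ⟨w, hw⟩ : ∃ w, fderiv ℝ ρ p w ≠ 0 := by
    by_contra! h
    exact hne (ContinuousLinearMap.ext h)
  set A := fderiv ℝ ρ p with hA
  obtain ⟨ν, hν⟩ : ∃ ν, A ν = -1 := ⟨(-(A w)⁻¹) • w, by rw [map_smul]; simp [hw]⟩
  have hν0 : 0 < ‖ν‖ := by
    rw [norm_pos_iff]; rintro rfl; simp at hν
  have hs : HasStrictFDerivAt ρ A p := hρ.hasStrictFDerivAt (by simp)
  set η : ℝ := 1 / (2 * ‖ν‖) with hη
  have hη0 : 0 < η := by positivity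
  have h1 := hs.isLittleO.def hη0
  rw [nhds_prod_eq, Metric.nhds_basis_ball.prod_self.eventually_iff] at h1
  obtain ⟨δ1, hδ1, h1⟩ := h1
  obtain ⟨δ2, hδ2, h2⟩ := Metric.isOpen_iff.1 hU p hpU
  set δ := min δ1 δ2 with hδ
  have hδ0 : 0 < δ := lt_min hδ1 hδ2
  have h3 : ∀ x ∈ ball p δ, ∀ y ∈ ball p δ, |ρ x - ρ y - A (x - y)| ≤ η * ‖x - y‖ := by
    intro x hx y hy
    have := @h1 (x, y) ⟨ball_subset_ball (min_le_left _ _) hx, ball_subset_ball (min_le_left _ _) hy⟩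
    simpa using this
  set L := ‖A‖ + η with hL
  have hL0 : 0 < L := by have := norm_nonneg A; positivity
  have hlip : ∀ x ∈ ball p δ, ∀ y ∈ ball p δ, ρ x ≤ ρ y + L * ‖x - y‖ := by
    intro x hx y hy
    have a := (abs_le.1 (h3 x hx y hy)).2
    have b := (le_abs_self _).trans (A.le_opNorm (x - y))
    rw [hL]; nlinarith
  have hdir : ∀ x ∈ ball p δ, ∀ τ : ℝ, 0 ≤ τ → x + τ • ν ∈ ball p δ → ρ (x + τ • ν) ≤ ρ x - τ / 2 := by
    intro x hx τ hτ hx'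
    have a := (abs_le.1 (h3 _ hx' x hx)).2
    have e : x + τ • ν - x = τ • ν := by abel
    rw [e, map_smul, hν, norm_smul, Real.norm_of_nonneg hτ] at a
    have : η * (τ * ‖ν‖) = τ / 2 := by rw [hη]; field_simp
    rw [this] at a
    simp at a
    linarith
  set r := δ / (1 + 4 * L * ‖ν‖) with hr
  have hden : 0 < 1 + 4 * L * ‖ν‖ := by positivity
  have hr0 : 0 < r := by positivity
  have hrδ : r + 4 * L * r * ‖ν‖ = δ := by rw [hr]; field_simp
  refine ⟨r, hr0, 1 + 4 * L * ‖ν‖, ?_⟩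
  intro g C hC hd hbd x hx y hy
  set d := ‖x - y‖ with hdd
  have hd0 : 0 ≤ d := norm_nonneg _
  have hdr : d < 2 * r := by
    have a := mem_ball.1 hx.2
    have b := mem_ball.1 hy.2
    have := dist_triangle_right x y p
    rw [dist_eq_norm] at this
    linarith
  rcases hd0.eq_or_lt with h0 | hdpos
  · have : x = y := by rw [hdd] at h0; exact sub_eq_zero.1 (norm_eq_zero.1 h0.symm)
    rw [this]; simp
    positivity
  set s := 2 * L * d with hs'
  have hs0 : 0 < s := by positivity
  have inball : ∀ q ∈ ball p r, ∀ τ : ℝ, 0 ≤ τ → τ ≤ s → q + τ • ν ∈ ball p δ := by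
    intro q hq τ h0 h1
    rw [mem_ball, dist_eq_norm] at hq ⊢
    have e : q + τ • ν - p = (q - p) + τ • ν := by abel
    rw [e]
    refine (norm_add_le _ _).trans_lt ?_
    rw [norm_smul, Real.norm_of_nonneg h0]
    have : τ * ‖ν‖ ≤ 4 * L * r * ‖ν‖ := by
      apply mul_le_mul_of_nonneg_right _ hν0.le
      refine h1.trans ?_
      rw [hs']; nlinarith
    linarith
  have rsub : ball p r ⊆ ball p δ := by
    apply ball_subset_ball
    have : 0 ≤ 4 * L * r * ‖ν‖ := by positivity
    linarith
  have inΩ : ∀ q, q ∈ ball p δ → ρ q < 0 → q ∈ Ω := by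
    intro q h h'
    rw [hΩU]
    exact ⟨h2 (ball_subset_ball (min_le_right _ _) h), h'⟩
  have neg : ∀ q ∈ Ω, ρ q < 0 := by intro q hq; rw [hΩU] at hq; exact hq.2
  have up : ∀ q ∈ Ω ∩ ball p r, segment ℝ q (q + s • ν) ⊆ Ω := by
    intro q hq z hz
    rw [segment_eq_image'] at hz
    obtain ⟨θ, hθ, rfl⟩ := hz
    have e : q + θ • (q + s • ν - q) = q + (θ * s) • ν := by
      rw [add_sub_cancel_left, smul_smul]
    simp only [e]
    have h0 : 0 ≤ θ * s := mul_nonneg hθ.1 hs0.le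
    have hb := inball q hq.2 (θ * s) h0 (by nlinarith [hθ.2])
    apply inΩ _ hb
    have := hdir q (rsub hq.2) _ h0 hb
    linarith [neg q hq.1]
  have across : segment ℝ (x + s • ν) (y + s • ν) ⊆ Ω := by
    intro z hz
    rw [segment_eq_image'] at hz
    obtain ⟨θ, hθ, rfl⟩ := hz
    set q := x + θ • (y - x) with hq
    have hqs : q ∈ segment ℝ x y := by rw [segment_eq_image']; exact ⟨θ, hθ, rfl⟩
    have hqb : q ∈ ball p r := (convex_ball p r).segment_subset hx.2 hy.2 hqs
    have e : x + s • ν + θ • (y + s • ν - (x + s • ν)) = q + s • ν := by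
      rw [hq, add_sub_add_right_eq_sub]; abel
    simp only [e]
    have hb := inball q hqb s hs0.le le_rfl
    apply inΩ _ hb
    have a := hdir q (rsub hqb) s hs0.le hb
    have b := hlip q (rsub hqb) x (rsub hx.2)
    have c : ‖q - x‖ ≤ d := by
      rw [hq, add_sub_cancel_left, norm_smul, Real.norm_of_nonneg hθ.1, hdd, norm_sub_rev x y]
      have := norm_nonneg (y - x)
      nlinarith [hθ.2]
    have : L * ‖q - x‖ ≤ L * d := by gcongr
    have := neg x hx.1
    rw [hs'] at a
    linarith
  have e1 := seg_lip hd hbd (up x hx)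
  have e2 := seg_lip hd hbd across
  have e3 := seg_lip hd hbd (up y hy)
  have n1 : ∀ q : Cn n, ‖q - (q + s • ν)‖ = s * ‖ν‖ := by
    intro q
    rw [sub_add_cancel_left, norm_neg, norm_smul, Real.norm_of_nonneg hs0.le]
  rw [n1] at e1 e3
  rw [add_sub_add_right_eq_sub] at e2
  have t := abs_sub_le (g x) (g (x + s • ν)) (g y)
  have t' := abs_sub_le (g (x + s • ν)) (g (y + s • ν)) (g y)
  rw [abs_sub_comm] at e3
  calc |g x - g y| ≤ C * (s * ‖ν‖) + (C * ‖x - y‖ + C * (s * ‖ν‖)) := by linarith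
    _ = (1 + 4 * L * ‖ν‖) * C * ‖x - y‖ := by rw [hs', ← hdd]; ring

lemma lip_global {Ω : Set (Cn n)} (hc : IsCompact (closure Ω))
    (h : ∀ p ∈ closure Ω, ∃ r > 0, ∃ K, LipNear Ω (ball p r) K) :
    ∃ K : ℝ, 1 ≤ K ∧ ∀ (g : Cn n → ℝ) (C : ℝ), 0 ≤ C → (∀ z ∈ Ω, DifferentiableAt ℝ g z) →
      (∀ z ∈ Ω, |g z| ≤ C) →
      (∀ z ∈ Ω, ‖fderiv ℝ g z‖ ≤ C) → ∀ x ∈ Ω, ∀ y ∈ Ω, |g x - g y| ≤ K * C * ‖x - y‖ := by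
  choose! r hr K hK using h
  obtain ⟨t, ht, hcov⟩ := hc.elim_nhds_subcover (fun p => ball p (r p))
    (fun p hp => ball_mem_nhds p (hr p hp))
  have hcov' : closure Ω ⊆ ⋃ p : t, ball (p : Cn n) (r p) := by
    intro x hx
    obtain ⟨p, hp⟩ := mem_iUnion.1 (hcov hx)
    obtain ⟨hpt, hp⟩ := mem_iUnion.1 hp
    exact mem_iUnion.2 ⟨⟨p, hpt⟩, hp⟩
  obtain ⟨δ, hδ, hleb⟩ := lebesgue_number_lemma_of_metric hc (fun p : t => isOpen_ball) hcov'
  refine ⟨1 + ∑ p ∈ t, |K p| + 2 / δ, ?_, ?_⟩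
  · have : 0 ≤ ∑ p ∈ t, |K p| := Finset.sum_nonneg fun _ _ => abs_nonneg _
    have : 0 < 2 / δ := by positivity
    linarith
  intro g C hC hd hg hbd x hx y hy
  have hS : 0 ≤ ∑ p ∈ t, |K p| := Finset.sum_nonneg fun _ _ => abs_nonneg _
  have hδ2 : 0 < 2 / δ := by positivity
  have hN := norm_nonneg (x - y)
  by_cases hxy : ‖x - y‖ < δ
  · obtain ⟨⟨p, hpt⟩, hp⟩ := hleb x (subset_closure hx)
    have hyb : y ∈ ball x δ := by rw [mem_ball, dist_comm, dist_eq_norm]; exact hxy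
    have := hK p (ht p hpt) g C hC hd hbd x ⟨hx, hp (mem_ball_self hδ)⟩ y ⟨hy, hp hyb⟩
    refine this.trans ?_
    have hle : K p ≤ 1 + ∑ p ∈ t, |K p| + 2 / δ := by
      have := Finset.single_le_sum (f := fun p => |K p|) (fun _ _ => abs_nonneg _) hpt
      have := le_abs_self (K p)
      simp only at *
      linarith
    gcongr
  · push Not at hxy
    have a : |g x - g y| ≤ 2 * C := by
      have := abs_sub (g x) (g y)
      linarith [hg x hx, hg y hy]
    have b : 2 * C ≤ 2 / δ * C * ‖x - y‖ := by
      have : 2 / δ * C * δ ≤ 2 / δ * C * ‖x - y‖ := by gcongr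
      have e : 2 / δ * C * δ = 2 * C := by field_simp
      linarith
    refine a.trans (b.trans ?_)
    gcongr
    linarith

lemma lip_closure {Ω : Set (Cn n)} {g : Cn n → ℝ} {L : ℝ} (hg : ContinuousOn g (closure Ω))
    (h : ∀ x ∈ Ω, ∀ y ∈ Ω, |g x - g y| ≤ L * ‖x - y‖) :
    ∀ x ∈ closure Ω, ∀ y ∈ closure Ω, |g x - g y| ≤ L * ‖x - y‖ := by
  intro x hx y hy
  have hm : (x, y) ∈ closure (Ω ×ˢ Ω) := by rw [closure_prod_eq]; exact ⟨hx, hy⟩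
  refine le_on_closure (s := Ω ×ˢ Ω) (f := fun p : Cn n × Cn n => |g p.1 - g p.2|)
    (g := fun p => L * ‖p.1 - p.2‖) (fun p hp => h p.1 hp.1 p.2 hp.2) ?_ ?_ hm
  · rw [closure_prod_eq]
    exact ((hg.comp continuousOn_fst fun p hp => hp.1).sub
      (hg.comp continuousOn_snd fun p hp => hp.2)).abs
  · fun_prop

/-- Collected facts on the domain. -/
structure Dom (Ω : Set (Cn n)) (ρ : Cn n → ℝ) (R c K : ℝ) : Prop where
  isOpen : IsOpen Ω
  nonempty : Ω.Nonempty
  compact : IsCompact (closure Ω)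
  hR : 1 ≤ R
  hc : 0 < c
  hK : 1 ≤ K
  norm_le : ∀ z ∈ closure Ω, ‖z‖ ≤ R
  rho_abs : ∀ z ∈ closure Ω, |ρ z| ≤ R
  rho_nonpos : ∀ z ∈ closure Ω, ρ z ≤ 0
  rho_zero : ∀ z ∈ frontier Ω, ρ z = 0
  rho_cont : ContinuousOn ρ (closure Ω)
  rho_smooth : ∀ z ∈ Ω, ContDiffAt ℝ 2 ρ z
  lv_rho : ∀ z ∈ Ω, ∀ v, c * ‖v‖ ^ 2 ≤ lv ρ z v
  rho_lip : ∀ x ∈ closure Ω, ∀ y ∈ closure Ω, |ρ x - ρ y| ≤ K * ‖x - y‖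
  lip : ∀ (g : Cn n → ℝ) (C : ℝ), 0 ≤ C → (∀ z ∈ Ω, DifferentiableAt ℝ g z) →
      (∀ z ∈ Ω, |g z| ≤ C) →
      (∀ z ∈ Ω, ‖fderiv ℝ g z‖ ≤ C) → ∀ x ∈ Ω, ∀ y ∈ Ω, |g x - g y| ≤ K * C * ‖x - y‖

lemma D2_smul (g : Cn n → ℝ) (z v : Cn n) (r : ℝ) : D2 g z (r • v) (r • v) = r ^ 2 * D2 g z v v := by
  simp [D2]; ring

lemma lv_smul (g : Cn n → ℝ) (z v : Cn n) (r : ℝ) : lv g z (r • v) = r ^ 2 * lv g z v := by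
  unfold lv
  rw [smul_comm I r v, D2_smul, D2_smul]; ring

lemma dom_exists {Ω : Set (Cn n)} (h : IsSPCDomain Ω) : ∃ ρ R c K, Dom Ω ρ R c K := by
  obtain ⟨ho, hne, hb, U, ρ, hU, -, hcl, hρ, hpos, hΩ, hfr⟩ := h
  have hcomp : IsCompact (closure Ω) := hb.isCompact_closure
  have hsm : ∀ z ∈ U, ContDiffAt ℝ (⊤ : ℕ∞) ρ z := fun z hz => hρ.contDiffAt (hU.mem_nhds hz)
  have hsm2 : ∀ z ∈ U, ContDiffAt ℝ 2 ρ z := fun z hz => by exact_mod_cast contDiffAt_infty.1 (hsm z hz) 2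
  have hsm1 : ∀ z ∈ U, ContDiffAt ℝ 1 ρ z := fun z hz => by exact_mod_cast contDiffAt_infty.1 (hsm z hz) 1
  have hcontU : ContinuousOn ρ U := hρ.continuousOn
  have hcont : ContinuousOn ρ (closure Ω) := hcontU.mono hcl
  have hnonpos : ∀ z ∈ closure Ω, ρ z ≤ 0 := by
    intro z hz
    refine le_on_closure (s := Ω) (f := ρ) (g := fun _ => 0) ?_ hcont continuousOn_const hz
    intro x hx; rw [hΩ] at hx; exact hx.2.le
  have hzero : ∀ z ∈ frontier Ω, ρ z = 0 := by
    intro z hz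
    have hzc : z ∈ closure Ω := hz.1
    by_contra hne
    have : z ∈ Ω := by
      have : ρ z < 0 := lt_of_le_of_ne (hnonpos z hzc) hne
      rw [hΩ]; exact ⟨hcl hzc, this⟩
    rw [ho.frontier_eq] at hz
    exact hz.2 this
  have hlipn : ∀ p ∈ closure Ω, ∃ r > 0, ∃ K, LipNear Ω (ball p r) K := by
    intro p hp
    by_cases hpΩ : p ∈ Ω
    · exact lipNear_interior ho hpΩ
    · exact lipNear_boundary hU hΩ (hcl hp) (hsm1 p (hcl hp))
        (hfr p (by rw [ho.frontier_eq]; exact ⟨hp, hpΩ⟩))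
  obtain ⟨K, hK1, hK⟩ := lip_global hcomp hlipn
  obtain ⟨R1, hR1⟩ := hcomp.exists_bound_of_continuousOn hcont
  obtain ⟨R2, hR2⟩ := hcomp.exists_bound_of_continuousOn (f := fun z : Cn n => z) continuousOn_id
  have hd1 : ContinuousOn (fderiv ℝ ρ) U := (hρ.continuousOn_fderiv_of_isOpen hU (by simp))
  have hd2 : ContinuousOn (fderiv ℝ (fderiv ℝ ρ)) U :=
    ((hρ.fderiv_of_isOpen hU (m := 1) (by norm_cast)).continuousOn_fderiv_of_isOpen hU (by simp))
  obtain ⟨R3, hR3⟩ := hcomp.exists_bound_of_continuousOn (hd1.mono hcl)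
  obtain ⟨c, hc0, hc⟩ : ∃ c > 0, ∀ z ∈ closure Ω, ∀ v, c * ‖v‖ ^ 2 ≤ lv ρ z v := by
    set S : Set (Cn n × Cn n) := closure Ω ×ˢ sphere 0 1 with hS
    have hSc : IsCompact S := hcomp.prod (isCompact_sphere 0 1)
    have hlc : ContinuousOn (fun p : Cn n × Cn n => lv ρ p.1 p.2) S := by
      have a : ContinuousOn (fun p : Cn n × Cn n => fderiv ℝ (fderiv ℝ ρ) p.1) S :=
        (hd2.mono hcl).comp continuousOn_fst fun p hp => hp.1
      unfold lv D2
      have b : ContinuousOn (fun p : Cn n × Cn n => p.2) S := continuousOn_snd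
      have b' : ContinuousOn (fun p : Cn n × Cn n => I • p.2) S := b.const_smul I
      exact ((a.clm_apply b).clm_apply b).add ((a.clm_apply b').clm_apply b')
    have hp : ∀ p ∈ S, 0 < lv ρ p.1 p.2 := by
      rintro ⟨z, v⟩ ⟨hz, hv⟩
      have hv' : v ≠ 0 := by rintro rfl; simp at hv
      have := qf_pos (hpos z (hcl hz)).transpose hv'
      rw [qf_cHess (hsm2 z (hcl hz))] at this
      simp only
      linarith
    have key : ∃ c > 0, ∀ p ∈ S, c ≤ lv ρ p.1 p.2 := by
      rcases S.eq_empty_or_nonempty with he | hne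
      · exact ⟨1, one_pos, by simp [he]⟩
      · obtain ⟨p, hpS, hmin⟩ := hSc.exists_isMinOn hne hlc
        exact ⟨_, hp p hpS, fun q hq => hmin hq⟩
    obtain ⟨c, hc0, hc⟩ := key
    refine ⟨c, hc0, fun z hz v => ?_⟩
    by_cases hv : v = 0
    · subst hv; simp [lv, D2]
    · have hvn : 0 < ‖v‖ := norm_pos_iff.2 hv
      have := hc (z, ‖v‖⁻¹ • v) ⟨hz, by simp [norm_smul, hvn.ne']⟩
      simp only at this
      rw [lv_smul] at this
      have e : lv ρ z v = ‖v‖ ^ 2 * ((‖v‖⁻¹) ^ 2 * lv ρ z v) := by field_simp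
      rw [e, mul_comm c]
      gcongr
  set R := 1 + |R1| + |R2| + |R3| with hR
  have r1 := le_abs_self R1
  have r2 := le_abs_self R2
  have r3 := le_abs_self R3
  have q1 := abs_nonneg R1
  have q2 := abs_nonneg R2
  have q3 := abs_nonneg R3
  have hRpos : 1 ≤ R := by linarith
  refine ⟨ρ, R, c, K * R, ho, hne, hcomp, hRpos, hc0, ?_, ?_, ?_, hnonpos, hzero, hcont, ?_, ?_, ?_, ?_⟩
  · nlinarith
  · intro z hz; have := hR2 z hz; linarith
  · intro z hz; have := hR1 z hz; rw [Real.norm_eq_abs] at this; linarith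
  · intro z hz; exact hsm2 z (hcl (subset_closure hz))
  · intro z hz; exact hc z (subset_closure hz)
  · apply lip_closure hcont
    apply hK ρ R (by linarith)
    · intro z hz; exact (hsm2 z (hcl (subset_closure hz))).differentiableAt (by simp)
    · intro z hz; have := hR1 z (subset_closure hz); rw [Real.norm_eq_abs] at this; linarith
    · intro z hz; have := hR3 z (subset_closure hz); linarith
  · intro g C hC h1 h2 h3 x hx y hy
    refine (hK g C hC h1 h2 h3 x hx y hy).trans ?_
    gcongr
    nlinarith


/-! ### Extracting usable facts from the hypotheses -/

/-- Collected facts on the solution. -/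
structure Good (Ω : Set (Cn n)) (T C K : ℝ) (u φ : Cn n × ℝ → ℝ) (f : ℝ × Cn n × ℝ → ℝ) : Prop where
  u_cont : ContinuousOn u (closure Ω ×ˢ Ico (0 : ℝ) T)
  u_z : ∀ z ∈ Ω, ∀ t ∈ Ioo (0 : ℝ) T, ContDiffAt ℝ 2 (fun w => u (w, t)) z
  u_t : ∀ z ∈ Ω, ∀ t ∈ Ioo (0 : ℝ) T, DifferentiableAt ℝ (fun s => u (z, s)) t
  phi_cont : ContinuousOn φ (closure Ω ×ˢ Ico (0 : ℝ) T)
  phi_z : ∀ z ∈ Ω, ∀ t ∈ Ioo (0 : ℝ) T, ContDiffAt ℝ 2 (fun w => φ (w, t)) z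
  phi_abs : ∀ z ∈ closure Ω, ∀ t ∈ Ico (0 : ℝ) T, |φ (z, t)| ≤ C
  phi_lip : ∀ t ∈ Ico (0 : ℝ) T, ∀ x ∈ closure Ω, ∀ y ∈ closure Ω,
    |φ (x, t) - φ (y, t)| ≤ K * C * ‖x - y‖
  phi_time : ∀ z ∈ closure Ω, ∀ s ∈ Ico (0 : ℝ) T, ∀ t ∈ Ico (0 : ℝ) T,
    |φ (z, s) - φ (z, t)| ≤ C * |s - t|
  phi_lv : ∀ z ∈ Ω, ∀ t ∈ Ioo (0 : ℝ) T, ∀ v, |lv (fun w => φ (w, t)) z v| ≤ 2 * C * ‖v‖ ^ 2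
  pd : ∀ z ∈ Ω, ∀ t ∈ Ioo (0 : ℝ) T, (cHess (fun w => u (w, t)) z).transpose.PosDef
  pde : ∀ z ∈ Ω, ∀ t ∈ Ioo (0 : ℝ) T, deriv (fun s => u (z, s)) t
      = Real.log ((cHess (fun w => u (w, t)) z).transpose.det.re) + f (t, z, u (z, t))
  bdry : ∀ z ∈ frontier Ω, ∀ t ∈ Ico (0 : ℝ) T, u (z, t) = φ (z, t)
  at_zero : ∀ z ∈ closure Ω, |u (z, 0)| ≤ C
  f_anti : ∀ t ∈ Ioo (0 : ℝ) T, ∀ z ∈ Ω, ∀ r r' : ℝ, r ≤ r' → f (t, z, r') ≤ f (t, z, r)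
  f_abs : ∀ t ∈ Ioo (0 : ℝ) T, ∀ z ∈ Ω, ∀ r : ℝ, |f (t, z, r)| ≤ C
  f_time : ∀ s ∈ Ioo (0 : ℝ) T, ∀ t ∈ Ioo (0 : ℝ) T, ∀ z ∈ Ω, ∀ r : ℝ,
    |f (s, z, r) - f (t, z, r)| ≤ C * |s - t|
  f_lip : ∀ t ∈ Ioo (0 : ℝ) T, ∀ x ∈ Ω, ∀ y ∈ Ω, ∀ r : ℝ,
    |f (t, x, r) - f (t, y, r)| ≤ K * C * ‖x - y‖

lemma C21.cont {Ω : Set (Cn n)} {T : ℝ} {u : Cn n × ℝ → ℝ} (h : C21 n Ω T u) :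
    ContinuousOn u (closure Ω ×ˢ Ico (0 : ℝ) T) := by
  obtain ⟨h1, h2, h3, -⟩ := h
  rintro ⟨z0, t0⟩ hp0
  have hg := h3 (z0, t0) hp0
  set g : Cn n × ℝ → ℝ := fun p => derivWithin (fun s => u (p.1, s)) (Ico (0 : ℝ) T) p.2 with hgdef
  set B := |g (z0, t0)| + 1 with hB
  have hev : ∀ᶠ p in 𝓝[closure Ω ×ˢ Ico (0 : ℝ) T] (z0, t0), |g p| < B :=
    hg.abs.eventually_lt continuousWithinAt_const (by simp [hB])
  rw [Filter.Eventually, Metric.mem_nhdsWithin_iff] at hev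
  obtain ⟨δ, hδ, hev⟩ := hev
  have key : ∀ᶠ p in 𝓝[closure Ω ×ˢ Ico (0 : ℝ) T] (z0, t0), ‖u p - u (p.1, t0)‖ ≤ B * |p.2 - t0| := by
    rw [Filter.Eventually, Metric.mem_nhdsWithin_iff]
    refine ⟨δ, hδ, ?_⟩
    rintro ⟨z, t⟩ ⟨hb, hz, ht⟩
    rw [← ball_prod_same] at hb
    have hconv : Convex ℝ (Ico (0 : ℝ) T ∩ ball t0 δ) := (convex_Ico 0 T).inter (convex_ball _ _)
    have := hconv.norm_image_sub_le_of_norm_hasDerivWithin_le (f := fun s => u (z, s))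
      (f' := fun s => g (z, s)) (C := B) (x := t0) (y := t) (𝕜 := ℝ) ?_ ?_ ⟨hp0.2, mem_ball_self hδ⟩ ⟨ht, hb.2⟩
    · simpa using this
    · intro s hs
      have := ((h2 z hz).differentiableOn (by simp) s hs.1).hasDerivWithinAt
      exact this.mono inter_subset_left
    · intro s hs
      have : (z, s) ∈ ball (z0, t0) δ ∩ (closure Ω ×ˢ Ico (0 : ℝ) T) := by
        rw [← ball_prod_same]
        exact ⟨⟨hb.1, hs.2⟩, hz, hs.1⟩
      have := hev this
      simpa using le_of_lt this
  have l1 : Tendsto (fun p : Cn n × ℝ => u p - u (p.1, t0)) (𝓝[closure Ω ×ˢ Ico (0 : ℝ) T] (z0, t0)) (𝓝 0) := by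
    refine squeeze_zero_norm' key ?_
    have : ContinuousAt (fun p : Cn n × ℝ => B * |p.2 - t0|) (z0, t0) := by fun_prop
    have := this.tendsto.mono_left (nhdsWithin_le_nhds (s := closure Ω ×ˢ Ico (0 : ℝ) T))
    simpa using this
  have l2 : ContinuousWithinAt (fun p : Cn n × ℝ => u (p.1, t0)) (closure Ω ×ˢ Ico (0 : ℝ) T) (z0, t0) := by
    have a := (h1 t0 hp0.2).continuousOn z0 hp0.1
    exact ContinuousWithinAt.comp (f := Prod.fst) (g := fun z => u (z, t0)) (t := closure Ω) a
      continuousWithinAt_fst (fun p hp => hp.1)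
  have := l1.add l2.tendsto
  simpa [ContinuousWithinAt] using this

lemma aprioriHyps_good {Ω : Set (Cn n)} {ρ : Cn n → ℝ} {R c K : ℝ} (D : Dom Ω ρ R c K)
    {T Cu Cp Cf C : ℝ} (hT : 0 < T) (hC : 1 ≤ C) (h1 : Cu ≤ C) (h2 : Cp ≤ C) (h3 : Cf ≤ C)
    {u φ : Cn n × ℝ → ℝ} {f : ℝ × Cn n × ℝ → ℝ} (h : AprioriHyps n Ω T Cu Cp Cf u φ f) :
    Good Ω T C K u φ f := by
  obtain ⟨hφ, hf, hu, h21, hpd, hpde, hbd, hin, hfm, hfC, hφC⟩ := h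
  have hC0 : 0 ≤ C := by linarith
  have hopen : IsOpen (Ω ×ˢ Ioo (0:ℝ) T) := D.isOpen.prod isOpen_Ioo
  have hu2 : ∀ z ∈ Ω, ∀ t ∈ Ioo (0:ℝ) T, ContDiffAt ℝ 2 u (z, t) := fun z hz t ht => by
    exact_mod_cast contDiffAt_infty.1 (hu.contDiffAt (hopen.mem_nhds ⟨hz, ht⟩)) 2
  have hφ2 : ∀ z ∈ Ω, ∀ t ∈ Ioo (0:ℝ) T, ContDiffAt ℝ 2 φ (z, t) := fun z hz t ht => by
    have : closure Ω ×ˢ Ico (0 : ℝ) T ∈ 𝓝 (z, t) :=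
      mem_of_superset (hopen.mem_nhds ⟨hz, ht⟩) (prod_mono subset_closure Ioo_subset_Ico_self)
    exact_mod_cast contDiffAt_infty.1 (hφ.contDiffAt this) 2
  have hopenf : IsOpen (Ioo (0:ℝ) T ×ˢ Ω ×ˢ (univ : Set ℝ)) := isOpen_Ioo.prod (D.isOpen.prod isOpen_univ)
  have hf2 : ∀ z ∈ Ω, ∀ t ∈ Ioo (0:ℝ) T, ∀ r, DifferentiableAt ℝ f (t, z, r) := fun z hz t ht r => by
    have : Ico (0 : ℝ) T ×ˢ closure Ω ×ˢ (univ : Set ℝ) ∈ 𝓝 (t, z, r) :=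
      mem_of_superset (hopenf.mem_nhds ⟨ht, hz, mem_univ _⟩)
        (prod_mono Ioo_subset_Ico_self (prod_mono subset_closure subset_rfl))
    exact (hf.contDiffAt this).differentiableAt (by simp)
  have hfd : ∀ z ∈ Ω, ∀ t ∈ Ioo (0:ℝ) T, ∀ r, ‖fderiv ℝ f (t, z, r)‖ ≤ C := fun z hz t ht r => by
    have := hfC 1 (by norm_num) (t, z, r) ⟨ht, hz, mem_univ _⟩
    rw [norm_iteratedFDeriv_one] at this
    linarith
  have hfa : ∀ t ∈ Ioo (0 : ℝ) T, ∀ z ∈ Ω, ∀ r : ℝ, |f (t, z, r)| ≤ C := fun t ht z hz r => by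
    have := hfC 0 (by norm_num) (t, z, r) ⟨ht, hz, mem_univ _⟩
    rw [norm_iteratedFDeriv_zero, Real.norm_eq_abs] at this
    linarith
  have hzsl : ∀ (z : Cn n) (t : ℝ), ContDiffAt ℝ 2 (fun w : Cn n => (w, t)) z := fun z t =>
    contDiffAt_id.prodMk contDiffAt_const
  have htsl : ∀ (z : Cn n) (t : ℝ), DifferentiableAt ℝ (fun s : ℝ => (z, s)) t := fun z t =>
    (differentiableAt_const z).prodMk differentiableAt_id
  have hφz : ∀ z ∈ Ω, ∀ t ∈ Ioo (0 : ℝ) T, ContDiffAt ℝ 2 (fun w => φ (w, t)) z := fun z hz t ht =>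
    (hφ2 z hz t ht).comp z (hzsl z t)
  have hφt : ∀ z ∈ Ω, ∀ t ∈ Ioo (0 : ℝ) T, DifferentiableAt ℝ (fun s => φ (z, s)) t := fun z hz t ht =>
    ((hφ2 z hz t ht).differentiableAt (by simp)).comp t (htsl z t)
  have hφ0 : ∀ z ∈ Ω, ∀ t ∈ Ioo (0 : ℝ) T, |φ (z, t)| ≤ C := fun z hz t ht => by
    have := hφC 0 0 (by norm_num) z hz t ht
    rw [norm_iteratedFDeriv_zero, Real.norm_eq_abs, iteratedDeriv_zero] at this
    linarith
  have hφ1 : ∀ z ∈ Ω, ∀ t ∈ Ioo (0 : ℝ) T, ‖fderiv ℝ (fun w => φ (w, t)) z‖ ≤ C := fun z hz t ht => by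
    have := hφC 1 0 (by norm_num) z hz t ht
    rw [norm_iteratedFDeriv_one] at this
    simp only [iteratedDeriv_zero] at this
    linarith
  have hφt1 : ∀ z ∈ Ω, ∀ t ∈ Ioo (0 : ℝ) T, ‖deriv (fun s => φ (z, s)) t‖ ≤ C := fun z hz t ht => by
    have := hφC 0 1 (by norm_num) z hz t ht
    rw [norm_iteratedFDeriv_zero] at this
    simp only [iteratedDeriv_one] at this
    linarith
  have hcφ : ContinuousOn φ (closure Ω ×ˢ Ico (0 : ℝ) T) := hφ.continuousOn
  have hTc : ∀ T' : ℝ, 0 < T' → closure (Ioo 0 T') = Icc 0 T' := fun T' h => closure_Ioo h.ne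
  refine
    { u_cont := h21.cont
      u_z := fun z hz t ht => (hu2 z hz t ht).comp z (hzsl z t)
      u_t := fun z hz t ht => ((hu2 z hz t ht).differentiableAt (by simp)).comp t (htsl z t)
      phi_cont := hcφ
      phi_z := hφz
      phi_abs := ?_
      phi_lip := ?_
      phi_time := ?_
      phi_lv := ?_
      pd := fun z hz t ht => (hpd t ht z hz).transpose
      pde := fun z hz t ht => by rw [Matrix.det_transpose]; exact hpde z hz t ht
      bdry := hbd
      at_zero := ?_
      f_anti := ?_
      f_abs := hfa
      f_time := ?_
      f_lip := ?_ }
  · intro z hz t ht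
    have hT' : t < (t + T) / 2 ∧ (t + T) / 2 < T ∧ 0 < (t + T) / 2 := by
      have := ht.1; have := ht.2; refine ⟨?_, ?_, ?_⟩ <;> linarith
    obtain ⟨a, b, cc⟩ := hT'
    have hcl : closure (Ω ×ˢ Ioo 0 ((t + T) / 2)) = closure Ω ×ˢ Icc 0 ((t + T) / 2) := by
      rw [closure_prod_eq, hTc _ cc]
    have hsub : closure (Ω ×ˢ Ioo 0 ((t + T) / 2)) ⊆ closure Ω ×ˢ Ico (0 : ℝ) T := by
      rw [hcl]; exact prod_mono subset_rfl fun s hs => ⟨hs.1, hs.2.trans_lt b⟩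
    refine le_on_closure (s := Ω ×ˢ Ioo 0 ((t + T) / 2)) (f := fun p => |φ p|) (g := fun _ => C)
      (fun p hp => hφ0 p.1 hp.1 p.2 ⟨hp.2.1, hp.2.2.trans b⟩) (hcφ.mono hsub).abs continuousOn_const
      (by rw [hcl]; exact ⟨hz, ht.1, a.le⟩)
  · intro t ht x hx y hy
    have hT' : t < (t + T) / 2 ∧ (t + T) / 2 < T ∧ 0 < (t + T) / 2 := by
      have := ht.1; have := ht.2; refine ⟨?_, ?_, ?_⟩ <;> linarith
    obtain ⟨a, b, cc⟩ := hT'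
    have hcl : closure ((Ω ×ˢ Ω) ×ˢ Ioo 0 ((t + T) / 2)) = (closure Ω ×ˢ closure Ω) ×ˢ Icc 0 ((t + T) / 2) := by
      rw [closure_prod_eq, closure_prod_eq, hTc _ cc]
    refine le_on_closure (s := (Ω ×ˢ Ω) ×ˢ Ioo 0 ((t + T) / 2))
      (f := fun p : (Cn n × Cn n) × ℝ => |φ (p.1.1, p.2) - φ (p.1.2, p.2)|)
      (g := fun p => K * C * ‖p.1.1 - p.1.2‖) (x := ((x, y), t)) ?_ ?_ (by fun_prop)
      (by rw [hcl]; exact ⟨⟨hx, hy⟩, ht.1, a.le⟩)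
    · rintro ⟨⟨x, y⟩, s⟩ ⟨⟨hx, hy⟩, hs⟩
      have hs' : s ∈ Ioo 0 T := ⟨hs.1, hs.2.trans b⟩
      exact D.lip (fun w => φ (w, s)) C hC0 (fun z hz => (hφz z hz s hs').differentiableAt (by simp))
        (fun z hz => hφ0 z hz s hs') (fun z hz => hφ1 z hz s hs') x hx y hy
    · rw [hcl]
      refine ContinuousOn.abs (ContinuousOn.sub ?_ ?_)
      · exact hcφ.comp (f := fun p : (Cn n × Cn n) × ℝ => (p.1.1, p.2)) (by fun_prop)
          fun p hp => ⟨hp.1.1, hp.2.1, hp.2.2.trans_lt b⟩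
      · exact hcφ.comp (f := fun p : (Cn n × Cn n) × ℝ => (p.1.2, p.2)) (by fun_prop)
          fun p hp => ⟨hp.1.2, hp.2.1, hp.2.2.trans_lt b⟩
  · intro z hz s hs t ht
    obtain ⟨T', a, a', b, cc⟩ : ∃ T', s < T' ∧ t < T' ∧ T' < T ∧ 0 < T' := by
      refine ⟨(max s t + T) / 2, ?_⟩
      have := hs.1; have := hs.2; have := ht.2; have := le_max_left s t; have := le_max_right s t
      have : max s t < T := max_lt hs.2 ht.2
      refine ⟨?_, ?_, ?_, ?_⟩ <;> linarith
    have hcl : closure (Ω ×ˢ (Ioo 0 T' ×ˢ Ioo 0 T')) = closure Ω ×ˢ (Icc 0 T' ×ˢ Icc 0 T') := by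
      rw [closure_prod_eq, closure_prod_eq, hTc _ cc]
    refine le_on_closure (s := Ω ×ˢ (Ioo 0 T' ×ˢ Ioo 0 T'))
      (f := fun p : Cn n × (ℝ × ℝ) => |φ (p.1, p.2.1) - φ (p.1, p.2.2)|)
      (g := fun p => C * |p.2.1 - p.2.2|) (x := (z, (s, t))) ?_ ?_ (by fun_prop)
      (by rw [hcl]; exact ⟨hz, ⟨hs.1, a.le⟩, ht.1, a'.le⟩)
    · rintro ⟨z, ⟨s, t⟩⟩ ⟨hz, hs, ht⟩
      have := (convex_Ioo (0:ℝ) T').norm_image_sub_le_of_norm_deriv_le (𝕜 := ℝ) (f := fun s => φ (z, s)) (C := C)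
        (fun r hr => hφt z hz r ⟨hr.1, hr.2.trans b⟩) (fun r hr => hφt1 z hz r ⟨hr.1, hr.2.trans b⟩) ht hs
      simpa using this
    · rw [hcl]
      refine ContinuousOn.abs (ContinuousOn.sub ?_ ?_)
      · exact hcφ.comp (f := fun p : Cn n × (ℝ × ℝ) => (p.1, p.2.1)) (by fun_prop)
          fun p hp => ⟨hp.1, hp.2.1.1, hp.2.1.2.trans_lt b⟩
      · exact hcφ.comp (f := fun p : Cn n × (ℝ × ℝ) => (p.1, p.2.2)) (by fun_prop)
          fun p hp => ⟨hp.1, hp.2.2.1, hp.2.2.2.trans_lt b⟩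
  · intro z hz t ht v
    have := hφC 2 0 (by norm_num) z hz t ht
    simp only [iteratedDeriv_zero] at this
    have hb : ∀ v, |D2 (fun w => φ (w, t)) z v v| ≤ C * ‖v‖ ^ 2 := by
      intro v
      have e := iteratedFDeriv_two_apply (𝕜 := ℝ) (fun w => φ (w, t)) z ![v, v]
      simp only [Matrix.cons_val_zero, Matrix.cons_val_one] at e
      unfold D2
      rw [← e, ← Real.norm_eq_abs]
      refine (ContinuousMultilinearMap.le_opNorm _ _).trans ?_
      simp only [Fin.prod_univ_two, Matrix.cons_val_zero, Matrix.cons_val_one]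
      rw [sq]
      gcongr
      linarith
    unfold lv
    refine (abs_add_le _ _).trans ?_
    have a := hb v
    have b := hb (I • v)
    rw [norm_smul, Complex.norm_I, one_mul] at b
    linarith
  · intro z hz
    have hc0 : ContinuousOn (fun z => |u (z, 0)|) (closure Ω) :=
        (h21.cont.comp (f := fun z : Cn n => (z, (0:ℝ))) (by fun_prop) fun z hz => ⟨hz, le_rfl, hT⟩).abs
    exact le_on_closure (s := Ω) (f := fun z => |u (z, 0)|) (g := fun _ => C)
        (fun z hz => (hin z hz).trans h1) hc0 continuousOn_const hz
  · intro t ht z hz r r' hrr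
    have hdiff : Differentiable ℝ (fun y => f (t, z, y)) := fun y => by
      have := hf2 z hz t ht y
      exact this.comp y ((differentiableAt_const t).prodMk ((differentiableAt_const z).prodMk differentiableAt_id))
    exact antitone_of_deriv_nonpos hdiff (fun y => hfm t ht z hz y) hrr
  · intro s hs t ht z hz r
    have := (convex_Ioo (0:ℝ) T).norm_image_sub_le_of_norm_hasDerivWithin_le (𝕜 := ℝ) (f := fun s => f (s, z, r)) (C := C)
      (f' := fun s => fderiv ℝ f (s, z, r) (1, 0, 0))
      (fun q hq => ?_) (fun q hq => ?_) ht hs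
    · simpa using this
    · have a := (hf2 z hz q hq r).hasFDerivAt
      have b : HasDerivAt (fun s : ℝ => (s, z, r)) ((1 : ℝ), (0 : Cn n), (0 : ℝ)) q :=
        (hasDerivAt_id q).prodMk (hasDerivAt_const q (z, r))
      exact (a.comp_hasDerivAt q b).hasDerivWithinAt
    · refine ((fderiv ℝ f (q, z, r)).le_opNorm _).trans ?_
      have e : ‖((1 : ℝ), (0 : Cn n), (0 : ℝ))‖ = 1 := by simp [Prod.norm_def]
      rw [e, mul_one]; exact hfd z hz q hq r
  · intro t ht x hx y hy r
    have hsl : ∀ z, HasFDerivAt (fun w : Cn n => (t, w, r))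
        ((0 : Cn n →L[ℝ] ℝ).prod ((ContinuousLinearMap.id ℝ (Cn n)).prod 0)) z := fun z =>
      (hasFDerivAt_const t z).prodMk ((hasFDerivAt_id z).prodMk (hasFDerivAt_const r z))
    have hd : ∀ z ∈ Ω, HasFDerivAt (fun w => f (t, w, r)) _ z := fun z hz =>
      (hf2 z hz t ht r).hasFDerivAt.comp z (hsl z)
    refine D.lip (fun w => f (t, w, r)) C hC0 (fun z hz => (hd z hz).differentiableAt)
      (fun z hz => hfa t ht z hz r) (fun z hz => ?_) x hx y hy
    rw [(hd z hz).fderiv]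
    refine ContinuousLinearMap.opNorm_le_bound _ hC0 fun v => ?_
    have e : ‖((0 : ℝ), v, (0 : ℝ))‖ = ‖v‖ := by simp [Prod.norm_def]
    have := (fderiv ℝ f (t, z, r)).le_opNorm ((0 : ℝ), v, (0 : ℝ))
    rw [e] at this
    refine this.trans ?_
    gcongr
    exact hfd z hz t ht r


/-! ### A priori estimates -/

lemma line_locmax {Ω : Set (Cn n)} (hΩ : IsOpen Ω) {F : Cn n → ℝ} {z : Cn n} (hz : z ∈ Ω)
    (hF : ∀ w ∈ Ω, F w ≤ F z) (v : Cn n) : IsLocalMax (fun s : ℝ => F (z + s • v)) 0 := by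
  have hl : ContinuousAt (fun s : ℝ => z + s • v) 0 := by fun_prop
  have : ∀ᶠ s in 𝓝 (0 : ℝ), z + s • v ∈ Ω :=
    hl.eventually_mem (by simpa using hΩ.mem_nhds hz)
  filter_upwards [this] with s hs
  simpa using hF _ hs

lemma time_test_right {p : ℝ → ℝ} {p' t b : ℝ} (h : HasDerivAt p p' t) (hat : t < b)
    (hm : ∀ s ∈ Ioo t b, p s ≤ p t) : p' ≤ 0 := by
  have h1 : HasDerivWithinAt p p' (Ioi t) t := h.hasDerivWithinAt
  rw [hasDerivWithinAt_iff_tendsto_slope' (by simp)] at h1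
  refine le_of_tendsto h1 ?_
  have : Ioo t b ∈ 𝓝[>] t := Ioo_mem_nhdsGT hat
  filter_upwards [this] with s hs
  rw [slope_def_field]
  have := hm s hs
  apply div_nonpos_of_nonpos_of_nonneg <;> linarith [hs.1]

section
variable {Ω : Set (Cn n)} {ρ : Cn n → ℝ} {R c K T C : ℝ} {u φ : Cn n × ℝ → ℝ}
  {f : ℝ × Cn n × ℝ → ℝ}

lemma Good.ut (G : Good Ω T C K u φ f) {z : Cn n} (hz : z ∈ Ω) {t : ℝ} (ht : t ∈ Ioo 0 T) :
    HasDerivAt (fun s => u (z, s))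
      (Real.log ((cHess (fun w => u (w, t)) z).transpose.det.re) + f (t, z, u (z, t))) t := by
  rw [← G.pde z hz t ht]
  exact (G.u_t z hz t ht).hasDerivAt

lemma Good.qf (G : Good Ω T C K u φ f) {z : Cn n} (hz : z ∈ Ω) {t : ℝ} (ht : t ∈ Ioo 0 T) (v : Cn n) :
    qf (cHess (fun w => u (w, t)) z).transpose v = lv (fun w => u (w, t)) z v / 4 :=
  qf_cHess (G.u_z z hz t ht) v

lemma Good.slice (G : Good Ω T C K u φ f) {t : ℝ} (ht : t ∈ Ico 0 T) :
    ContinuousOn (fun z => u (z, t)) (closure Ω) :=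
  G.u_cont.comp (f := fun z : Cn n => (z, t)) (by fun_prop) fun z hz => ⟨hz, ht⟩

lemma Good.phi_slice (G : Good Ω T C K u φ f) {t : ℝ} (ht : t ∈ Ico 0 T) :
    ContinuousOn (fun z => φ (z, t)) (closure Ω) :=
  G.phi_cont.comp (f := fun z : Cn n => (z, t)) (by fun_prop) fun z hz => ⟨hz, ht⟩

lemma upper_barrier (hn : 0 < n) (D : Dom Ω ρ R c K) (G : Good Ω T C K u φ f) {t : ℝ}
    (ht : t ∈ Ioo 0 T) {z : Cn n} (hz : z ∈ closure Ω) :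
    u (z, t) ≤ φ (z, t) - 2 * C / c * ρ z := by
  have ht' : t ∈ Ico 0 T := ⟨ht.1.le, ht.2⟩
  set A := 2 * C / c with hA
  set F : Cn n → ℝ := fun z => u (z, t) - φ (z, t) + A * ρ z with hF
  have hFc : ContinuousOn F (closure Ω) :=
    ((G.slice ht').sub (G.phi_slice ht')).add (continuousOn_const.mul D.rho_cont)
  obtain ⟨y, hy, hmax⟩ := D.compact.exists_isMaxOn ⟨z, hz⟩ hFc
  have hFz : F z ≤ F y := hmax hz
  suffices h : F y ≤ 0 by
    simp only [hF] at hFz h ⊢; linarith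
  by_cases hyΩ : y ∈ Ω
  · exfalso
    have key : ∀ v, D2 (fun w => u (w, t)) y v v - D2 (fun w => φ (w, t)) y v v + A * D2 ρ y v v ≤ 0 := by
      intro v
      have tw := ((Tw.line (G.u_z y hyΩ t ht) v).sub (Tw.line (G.phi_z y hyΩ t ht) v)).add
        ((Tw.line (D.rho_smooth y hyΩ) v).const_mul A)
      exact tw.le (line_locmax D.isOpen (F := F) hyΩ (fun w hw => hmax (subset_closure hw)) v)
    set v : Cn n := cvec n ⟨0, hn⟩ 1 with hv
    have hv0 : v ≠ 0 := by
      intro h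
      have := congrArg (fun x : Cn n => x ⟨0, hn⟩) h
      simp [hv, cvec] at this
    have p := qf_pos (G.pd y hyΩ t ht) hv0
    rw [G.qf hyΩ ht] at p
    have a := key v
    have b := key (I • v)
    have q := (abs_le.1 (G.phi_lv y hyΩ t ht v)).2
    have r := D.lv_rho y hyΩ v
    have hAc : A * c = 2 * C := by rw [hA]; field_simp [D.hc.ne']
    have hA0 : 0 ≤ A := by
      have h0 := (abs_nonneg _).trans (G.at_zero y hy)
      have := D.hc
      positivity
    have : A * (c * ‖v‖ ^ 2) ≤ A * lv ρ y v := by gcongr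
    unfold lv at p q this
    nlinarith
  · have hfr : y ∈ frontier Ω := by rw [D.isOpen.frontier_eq]; exact ⟨hy, hyΩ⟩
    simp [hF, G.bdry y hfr t ht', D.rho_zero y hfr]

lemma bound_u (hn : 0 < n) (D : Dom Ω ρ R c K) (hT : 0 < T) (hC : 1 ≤ C) :
    ∃ C1 : ℝ, 1 ≤ C1 ∧ ∀ u φ f, Good Ω T C K u φ f → ∀ z ∈ closure Ω, ∀ t ∈ Ico 0 T, |u (z, t)| ≤ C1 := by
  have hR := D.hR
  have hc := D.hc
  set B := C + n * |Real.log (c / 4)| + 1 with hB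
  have hB0 : 0 < B := by positivity
  set A := 2 * C / c with hA
  have hA0 : 0 < A := by positivity
  refine ⟨C + A * R + R + B * T, by nlinarith [mul_pos hA0 (by linarith : 0 < R), mul_pos hB0 hT], ?_⟩
  intro u φ f G z hz t1 ht1
  have hAR := mul_pos hA0 (by linarith : 0 < R)
  have hBT := mul_pos hB0 hT
  rw [abs_le]
  constructor
  · set F : Cn n × ℝ → ℝ := fun p => ρ p.1 - C - B * p.2 - u p with hF
    have hsub : closure Ω ×ˢ Icc 0 t1 ⊆ closure Ω ×ˢ Ico 0 T :=
      prod_mono subset_rfl fun s hs => ⟨hs.1, hs.2.trans_lt ht1.2⟩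
    have hFc : ContinuousOn F (closure Ω ×ˢ Icc 0 t1) := by
      refine ContinuousOn.sub (ContinuousOn.sub (ContinuousOn.sub ?_ continuousOn_const) (by fun_prop))
        (G.u_cont.mono hsub)
      exact D.rho_cont.comp continuousOn_fst fun p hp => hp.1
    obtain ⟨⟨y, t⟩, ⟨hy, ht⟩, hmax⟩ := (D.compact.prod isCompact_Icc).exists_isMaxOn
      (⟨(z, t1), hz, ht1.1, le_rfl⟩ : (closure Ω ×ˢ Icc 0 t1).Nonempty) hFc
    simp only at hy ht
    have h1 : F (z, t1) ≤ F (y, t) := hmax (⟨hz, ht1.1, le_rfl⟩ : (z, t1) ∈ closure Ω ×ˢ Icc 0 t1)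
    suffices h : F (y, t) ≤ 0 by
      have h2 : ρ z - C - B * t1 - u (z, t1) ≤ 0 := h1.trans h
      have := (abs_le.1 (D.rho_abs z hz)).1
      have : B * t1 ≤ B * T := by have := ht1.2.le; gcongr
      linarith
    have htI : t ∈ Ico 0 T := ⟨ht.1, ht.2.trans_lt ht1.2⟩
    by_cases hyΩ : y ∈ Ω
    · rcases ht.1.eq_or_lt with h0 | h0
      · have a := (abs_le.1 (G.at_zero y hy)).1
        have b := D.rho_nonpos y hy
        simp only [hF, ← h0]; linarith
      · exfalso
        have hto : t ∈ Ioo 0 T := ⟨h0, htI.2⟩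
        have hd : HasDerivAt (fun s => F (y, s)) (-B - (Real.log ((cHess (fun w => u (w, t)) y).transpose.det.re)
            + f (t, y, u (y, t)))) t := by
          have a : HasDerivAt (fun s => ρ y - C - B * s) (-B) t := by
            simpa using ((hasDerivAt_id t).const_mul B).const_sub (ρ y - C)
          exact a.sub (G.ut hyΩ hto)
        have hq := time_test hd h0 (fun s hs => hmax (⟨hy, hs.1, hs.2.trans ht.2⟩ : (y, s) ∈ closure Ω ×ˢ Icc 0 t1))
        have key : ∀ v, D2 ρ y v v - D2 (fun w => u (w, t)) y v v ≤ 0 := by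
          intro v
          have tw := (((Tw.line (D.rho_smooth y hyΩ) v).sub (Tw.const C)).sub (Tw.const (B * t))).sub
            (Tw.line (G.u_z y hyΩ t hto) v)
          have := tw.le (line_locmax D.isOpen (F := fun w => F (w, t)) hyΩ
            (fun w hw => hmax (⟨subset_closure hw, ht⟩ : (w, t) ∈ closure Ω ×ˢ Icc 0 t1)) v)
          linarith
        have hlog := log_det_ge (G.pd y hyΩ t hto) (c := c / 4) (by positivity) (fun v => by
          rw [G.qf hyΩ hto]
          have a := D.lv_rho y hyΩ v
          have := key v
          have := key (I • v)
          unfold lv at *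
          linarith)
        have hfa := (abs_le.1 (G.f_abs t hto y hyΩ (u (y, t)))).1
        have : (n : ℝ) * (-|Real.log (c / 4)|) ≤ n * Real.log (c / 4) := by
          gcongr; exact neg_abs_le _
        linarith
    · have hfr : y ∈ frontier Ω := by rw [D.isOpen.frontier_eq]; exact ⟨hy, hyΩ⟩
      have a := (abs_le.1 (G.phi_abs y hy t htI)).1
      have : 0 ≤ B * t := mul_nonneg hB0.le ht.1
      simp only [hF, G.bdry y hfr t htI, D.rho_zero y hfr]
      linarith
  · rcases ht1.1.eq_or_lt with h0 | h0
    · have := (abs_le.1 (G.at_zero z hz)).2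
      rw [← h0]; linarith
    · have := upper_barrier hn D G ⟨h0, ht1.2⟩ hz
      have a := (abs_le.1 (G.phi_abs z hz t1 ht1)).2
      have b := (abs_le.1 (D.rho_abs z hz)).1
      have : A * (-R) ≤ A * ρ z := by gcongr
      linarith

set_option maxHeartbeats 1000000 in
lemma bound_ut (D : Dom Ω ρ R c K) (hT : 0 < T) (hC : 1 ≤ C) {C1 : ℝ} (hC1 : 1 ≤ C1) :
    ∃ C2 : ℝ, 0 < C2 ∧ ∀ u φ f, Good Ω T C K u φ f →
      (∀ z ∈ closure Ω, ∀ t ∈ Ico 0 T, |u (z, t)| ≤ C1) →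
      ∀ z ∈ Ω, ∀ t ∈ Ioo 0 T, Real.log ((cHess (fun w => u (w, t)) z).transpose.det.re)
        + f (t, z, u (z, t)) ≤ C2 / t := by
  set C' := C1 + n + C * T + C + 1 with hC'
  have hn0 : (0:ℝ) ≤ n := Nat.cast_nonneg n
  have hCT : 0 < C * T := by positivity
  have hC'0 : 0 < C' := by positivity
  refine ⟨C1 + 2 * C' * (1 + T), by positivity, ?_⟩
  intro u φ f G hb
  have main : ∀ l T' : ℝ, 1 < l → 0 ≤ T' → l * T' < T → ∀ z ∈ closure Ω, ∀ t ∈ Icc 0 T',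
      u (z, l * t) / l - u (z, t) - C' * (l - 1) * (1 + t) ≤ 0 := by
    intro l T' hl hT' hlT z hz t ht
    have hl0 : 0 < l := by linarith
    have hl1 : 0 < l - 1 := by linarith
    have hT'T : T' < T := by nlinarith
    set F : Cn n × ℝ → ℝ := fun p => u (p.1, l * p.2) / l - u p - C' * (l - 1) * (1 + p.2) with hF
    have hmem : ∀ s ∈ Icc 0 T', l * s ∈ Ico 0 T := fun s hs =>
      ⟨mul_nonneg hl0.le hs.1, lt_of_le_of_lt (by have := hs.2; gcongr) hlT⟩
    have hmem' : ∀ s ∈ Icc 0 T', s ∈ Ico 0 T := fun s hs => ⟨hs.1, hs.2.trans_lt hT'T⟩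
    have hFc : ContinuousOn F (closure Ω ×ˢ Icc 0 T') := by
      refine ContinuousOn.sub (ContinuousOn.sub (ContinuousOn.div_const ?_ l)
        (G.u_cont.mono (prod_mono subset_rfl hmem'))) (by fun_prop)
      exact G.u_cont.comp (f := fun p : Cn n × ℝ => (p.1, l * p.2)) (by fun_prop)
        fun p hp => ⟨hp.1, hmem _ hp.2⟩
    obtain ⟨⟨y, r⟩, ⟨hy, hr⟩, hmax⟩ := (D.compact.prod isCompact_Icc).exists_isMaxOn
      (⟨(z, t), hz, ht⟩ : (closure Ω ×ˢ Icc 0 T').Nonempty) hFc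
    simp only at hy hr
    have h1 : F (z, t) ≤ F (y, r) := hmax (⟨hz, ht⟩ : (z, t) ∈ closure Ω ×ˢ Icc 0 T')
    refine le_trans h1 ?_
    by_contra! hpos
    have hpos' : 0 < u (y, l * r) / l - u (y, r) - C' * (l - 1) * (1 + r) := hpos
    have hr1 : C' * (l - 1) ≤ C' * (l - 1) * (1 + r) := by
      have : 0 ≤ C' * (l - 1) * r := mul_nonneg (by positivity) hr.1
      linarith
    have hur : u (y, r) < u (y, l * r) / l - C' * (l - 1) := by linarith
    have hinv : ∀ a : ℝ, |a| ≤ C → a / l ≤ a + C * (l - 1) := by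
      intro a ha
      rw [div_le_iff₀ hl0]
      have := (abs_le.1 ha).1
      have h2 : C * 1 ≤ C * l := by gcongr
      have h3 : 0 ≤ a + C * l := by linarith
      have h4 := mul_nonneg hl1.le h3
      have h5 : (a + C * (l - 1)) * l = a + (l - 1) * (a + C * l) := by ring
      linarith
    by_cases hyΩ : y ∈ Ω
    · rcases hr.1.eq_or_lt with h0 | h0
      · rw [← h0, mul_zero] at hur
        have := hinv _ (G.at_zero y hy)
        nlinarith
      · have hro : r ∈ Ioo 0 T := ⟨h0, (hmem' r hr).2⟩
        have hlro : l * r ∈ Ioo 0 T := ⟨by positivity, (hmem r hr).2⟩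
        have hd : HasDerivAt (fun s => F (y, s))
            ((Real.log ((cHess (fun w => u (w, l * r)) y).transpose.det.re) + f (l * r, y, u (y, l * r)))
              - (Real.log ((cHess (fun w => u (w, r)) y).transpose.det.re) + f (r, y, u (y, r)))
              - C' * (l - 1)) r := by
          have a : HasDerivAt (fun s : ℝ => l * s) l r := by
            simpa using (hasDerivAt_id r).const_mul l
          have b := ((G.ut hyΩ hlro).comp r a).div_const l
          rw [mul_div_assoc, div_self hl0.ne', mul_one] at b
          have e : HasDerivAt (fun s : ℝ => C' * (l - 1) * (1 + s)) (C' * (l - 1)) r := by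
            simpa using ((hasDerivAt_id r).const_add 1).const_mul (C' * (l - 1))
          exact (b.sub (G.ut hyΩ hro)).sub e
        have hq := time_test hd h0 (fun s hs => hmax (⟨hy, hs.1, hs.2.trans hr.2⟩ : (y, s) ∈ closure Ω ×ˢ Icc 0 T'))
        have key : ∀ v, l⁻¹ * D2 (fun w => u (w, l * r)) y v v - D2 (fun w => u (w, r)) y v v ≤ 0 := by
          intro v
          have tw := (((Tw.line (G.u_z y hyΩ _ hlro) v).const_mul l⁻¹).sub (Tw.line (G.u_z y hyΩ r hro) v)).sub
            (Tw.const (C' * (l - 1) * (1 + r)))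
          have hm := line_locmax D.isOpen (F := fun w => F (w, r)) hyΩ
            (fun w hw => hmax (⟨subset_closure hw, hr⟩ : (w, r) ∈ closure Ω ×ˢ Icc 0 T')) v
          have := tw.le (by simpa [hF, div_eq_inv_mul] using hm)
          linarith
        have hqf : ∀ v, qf (cHess (fun w => u (w, l * r)) y).transpose v ≤
            l * qf (cHess (fun w => u (w, r)) y).transpose v := by
          intro v
          rw [G.qf hyΩ hlro, G.qf hyΩ hro]
          have a : l * (l⁻¹ * lv (fun w => u (w, l * r)) y v - lv (fun w => u (w, r)) y v) ≤ 0 := by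
            apply mul_nonpos_of_nonneg_of_nonpos hl0.le
            have := key v
            have := key (I • v)
            unfold lv
            linarith
          rw [mul_sub, ← mul_assoc, mul_inv_cancel₀ hl0.ne', one_mul] at a
          linarith
        have hH := G.pd y hyΩ r hro
        have hlog := log_det_concave hH (G.pd y hyΩ _ hlro)
        have hsum : ∑ i, (qf (cHess (fun w => u (w, l * r)) y).transpose (hH.1.eigenvectorBasis i)
            / hH.1.eigenvalues i - 1) ≤ n * (l - 1) := by
          have : ∀ i ∈ Finset.univ, (qf (cHess (fun w => u (w, l * r)) y).transpose (hH.1.eigenvectorBasis i)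
            / hH.1.eigenvalues i - 1) ≤ l - 1 := by
            intro i _
            have a := hqf (hH.1.eigenvectorBasis i)
            rw [qf_eigen hH i] at a
            have := (div_le_iff₀ (hH.eigenvalues_pos i)).2 a
            linarith
          have := Finset.sum_le_card_nsmul _ _ _ this
          simpa using this
        have hf1 := (abs_le.1 (G.f_time _ hlro r hro y hyΩ (u (y, l * r)))).2
        have habs : |l * r - r| = (l - 1) * r := by
          rw [show l * r - r = (l - 1) * r by ring, abs_of_pos (by positivity)]
        rw [habs] at hf1
        have hmono : u (y, r) ≤ u (y, l * r) := by
          have a := (abs_le.1 (hb y hy r (hmem' r hr))).1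
          have e : u (y, l * r) = l * (u (y, l * r) / l) := by field_simp
          have : l * (u (y, r) + C' * (l - 1)) ≤ l * (u (y, l * r) / l) := by gcongr; linarith
          have h2 : 0 ≤ (l - 1) * (u (y, r) + l * C') := by
            apply mul_nonneg hl1.le; nlinarith
          nlinarith
        have hf2 := G.f_anti r hro y hyΩ _ _ hmono
        have hrT : C * ((l - 1) * r) ≤ C * T * (l - 1) := by
          have : r ≤ T := hro.2.le
          have : C * ((l - 1) * r) ≤ C * ((l - 1) * T) := by gcongr
          linarith
        have : C' * (l - 1) ≤ (n + C * T) * (l - 1) := by linarith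
        have := le_of_mul_le_mul_right this hl1
        linarith
    · have hfr : y ∈ frontier Ω := by rw [D.isOpen.frontier_eq]; exact ⟨hy, hyΩ⟩
      rw [G.bdry y hfr _ (hmem r hr), G.bdry y hfr _ (hmem' r hr)] at hur
      have a := hinv _ (G.phi_abs y hy _ (hmem r hr))
      have b := (abs_le.1 (G.phi_time y hy _ (hmem r hr) r (hmem' r hr))).2
      have habs : |l * r - r| = (l - 1) * r := by
        rw [show l * r - r = (l - 1) * r by ring, abs_of_nonneg (mul_nonneg hl1.le hr.1)]
      rw [habs] at b
      have hrT : C * ((l - 1) * r) ≤ C * T * (l - 1) := by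
        have : r ≤ T := (hmem' r hr).2.le
        have : C * ((l - 1) * r) ≤ C * ((l - 1) * T) := by gcongr
        linarith
      have : C' * (l - 1) < (C * T + C) * (l - 1) := by linarith
      have := lt_of_mul_lt_mul_right this hl1.le
      linarith
  intro z hz t ht
  set C2 := C1 + 2 * C' * (1 + T) with hC2
  have hd := (G.ut hz ht).sub ((hasDerivAt_id t).const_mul (C2 / t))
  have hlt : t < min T (2 * t) := lt_min ht.2 (by linarith [ht.1])
  have := time_test_right hd hlt ?_
  · rw [mul_one] at this; linarith
  · intro s hs
    have hsT : s < T := hs.2.trans_le (min_le_left _ _)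
    have hs2 : s < 2 * t := hs.2.trans_le (min_le_right _ _)
    have ht0 := ht.1
    set l := s / t with hl
    have hls : l * t = s := by rw [hl]; field_simp
    have hl1 : 1 < l := by rw [hl, one_lt_div ht0]; exact hs.1
    have hl2 : l ≤ 2 := by rw [hl, div_le_iff₀ ht0]; exact hs2.le
    have m := main l t hl1 ht0.le (by rw [hls]; exact hsT) z (subset_closure hz) t ⟨ht0.le, le_rfl⟩
    rw [hls] at m
    have hl0 : 0 < l := by linarith
    have m2 : u (z, s) ≤ l * (u (z, t) + C' * (l - 1) * (1 + t)) := by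
      have : u (z, s) / l ≤ u (z, t) + C' * (l - 1) * (1 + t) := by linarith
      rw [div_le_iff₀ hl0] at this
      linarith
    have a := (abs_le.1 (hb z (subset_closure hz) t ⟨ht0.le, ht.2⟩)).2
    have m3 : l * (C' * (l - 1) * (1 + t)) ≤ 2 * (C' * (l - 1) * (1 + T)) := by
      have : 0 ≤ l - 1 := by linarith
      have := ht.2.le
      gcongr
    have m4 : (l - 1) * u (z, t) ≤ (l - 1) * C1 := by
      have : 0 ≤ l - 1 := by linarith
      gcongr
    have m5 : u (z, s) - u (z, t) ≤ C2 * (l - 1) := by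
      have e1 : l * (u (z, t) + C' * (l - 1) * (1 + t)) =
        u (z, t) + (l - 1) * u (z, t) + l * (C' * (l - 1) * (1 + t)) := by ring
      have e2 : C2 * (l - 1) = (l - 1) * C1 + 2 * (C' * (l - 1) * (1 + T)) := by rw [hC2]; ring
      linarith
    have m6 : C2 / t * s - C2 / t * t = C2 * (l - 1) := by rw [hl]; field_simp
    simp only [Pi.sub_apply, id]
    linarith

lemma bound_bdry (hn : 0 < n) (D : Dom Ω ρ R c K) (hC : 1 ≤ C) {C2 t0 : ℝ} (hC2 : 0 < C2)
    (ht0 : 0 < t0) :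
    ∃ CB : ℝ, 0 < CB ∧ ∀ u φ f, Good Ω T C K u φ f →
      (∀ z ∈ Ω, ∀ t ∈ Ioo 0 T, Real.log ((cHess (fun w => u (w, t)) z).transpose.det.re)
        + f (t, z, u (z, t)) ≤ C2 / t) →
      ∀ t ∈ Ico t0 T, ∀ x ∈ closure Ω, ∀ y ∈ closure Ω, (x ∉ Ω ∨ y ∉ Ω) →
        u (x, t) - u (y, t) ≤ CB * ‖x - y‖ := by
  have hK := D.hK
  have hc := D.hc
  set Δ := C2 / t0 + C with hΔ
  have hΔ0 : 0 < Δ := by positivity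
  set A := (4 * Real.exp (Δ + 1) + 2 * C) / c with hA
  have hexp := Real.exp_pos (Δ + 1)
  have hA0 : 0 < A := by positivity
  refine ⟨K * C + A * K, by positivity, ?_⟩
  intro u φ f G hb t ht
  have hto : t ∈ Ioo 0 T := ⟨ht0.trans_le ht.1, ht.2⟩
  have ht' : t ∈ Ico 0 T := ⟨hto.1.le, ht.2⟩
  have up : ∀ z ∈ closure Ω, u (z, t) ≤ φ (z, t) - A * ρ z := by
    intro z hz
    have a := upper_barrier hn D G hto hz
    have b := D.rho_nonpos z hz
    have : 2 * C / c ≤ A := by rw [hA]; gcongr; linarith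
    nlinarith
  have lo : ∀ z ∈ closure Ω, φ (z, t) + A * ρ z ≤ u (z, t) := by
    intro z hz
    set F : Cn n → ℝ := fun z => φ (z, t) + A * ρ z - u (z, t) with hF
    have hFc : ContinuousOn F (closure Ω) :=
      ((G.phi_slice ht').add (continuousOn_const.mul D.rho_cont)).sub (G.slice ht')
    obtain ⟨y, hy, hmax⟩ := D.compact.exists_isMaxOn ⟨z, hz⟩ hFc
    have hFz : F z ≤ F y := hmax hz
    suffices h : F y ≤ 0 by
      simp only [hF] at hFz h ⊢; linarith
    by_cases hyΩ : y ∈ Ω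
    · exfalso
      have key : ∀ v, D2 (fun w => φ (w, t)) y v v + A * D2 ρ y v v - D2 (fun w => u (w, t)) y v v ≤ 0 := by
        intro v
        have tw := ((Tw.line (G.phi_z y hyΩ t hto) v).add
          ((Tw.line (D.rho_smooth y hyΩ) v).const_mul A)).sub (Tw.line (G.u_z y hyΩ t hto) v)
        exact tw.le (line_locmax D.isOpen (F := F) hyΩ (fun w hw => hmax (subset_closure hw)) v)
      have hlog := log_det_ge (G.pd y hyΩ t hto) hexp (fun v => by
        rw [G.qf hyΩ hto]
        have a := key v
        have b := key (I • v)
        have q := (abs_le.1 (G.phi_lv y hyΩ t hto v)).1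
        have r := D.lv_rho y hyΩ v
        have hAc : A * c = 4 * Real.exp (Δ + 1) + 2 * C := by rw [hA]; field_simp
        have : A * (c * ‖v‖ ^ 2) ≤ A * lv ρ y v := by gcongr
        rw [← mul_assoc, hAc] at this
        unfold lv at *
        nlinarith)
      rw [Real.log_exp] at hlog
      have h1 := hb y hyΩ t hto
      have h2 := (abs_le.1 (G.f_abs t hto y hyΩ (u (y, t)))).1
      have h3 : C2 / t ≤ C2 / t0 := by
        have := ht.1
        gcongr
      have h4 : (1:ℝ) ≤ n := by exact_mod_cast hn
      nlinarith
    · have hfr : y ∈ frontier Ω := by rw [D.isOpen.frontier_eq]; exact ⟨hy, hyΩ⟩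
      simp [hF, G.bdry y hfr t ht', D.rho_zero y hfr]
  intro x hx y hy hxy
  have a := (abs_le.1 (G.phi_lip t ht' x hx y hy)).2
  have b := abs_le.1 (D.rho_lip x hx y hy)
  have b1 : A * (ρ x - ρ y) ≤ A * (K * ‖x - y‖) := by gcongr; exact b.2
  have b2 : A * (-(K * ‖x - y‖)) ≤ A * (ρ x - ρ y) := by gcongr; exact b.1
  rcases hxy with h | h
  · have hfr : x ∈ frontier Ω := by rw [D.isOpen.frontier_eq]; exact ⟨hx, h⟩
    have e1 := G.bdry x hfr t ht'
    have e2 := D.rho_zero x hfr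
    have := lo y hy
    rw [e2] at b1 b2
    nlinarith
  · have hfr : y ∈ frontier Ω := by rw [D.isOpen.frontier_eq]; exact ⟨hy, h⟩
    have e1 := G.bdry y hfr t ht'
    have e2 := D.rho_zero y hfr
    have := up x hx
    rw [e2] at b1 b2
    nlinarith

end



/-! ### The gradient estimate -/

lemma lin_alg_bound {H : Matrix (Fin n) (Fin n) ℂ} (hH : H.PosDef) (L : Cn n →L[ℝ] ℝ)
    {k A b E : ℝ} (hk : 0 < k) (hA : 0 < A) (hb : 0 < b) (hdet : H.det.re ≤ E)
    (hS : ∑ i, (k * ((L (hH.1.eigenvectorBasis i)) ^ 2 + (L (I • hH.1.eigenvectorBasis i)) ^ 2) + A)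
      / hH.1.eigenvalues i ≤ b) (h : Cn n) :
    (L h) ^ 2 ≤ n ^ 2 * ‖h‖ ^ 2 * (b / k * (E * (b / A) ^ (n - 1))) := by
  set w := hH.1.eigenvectorBasis with hw
  set lam := hH.1.eigenvalues with hlam
  set g : Fin n → ℝ := fun i => (L (w i)) ^ 2 + (L (I • w i)) ^ 2 with hg
  have hlp : ∀ i, 0 < lam i := hH.eigenvalues_pos
  have hg0 : ∀ i, 0 ≤ g i := fun i => by positivity
  have hterm : ∀ i, (k * g i + A) / lam i ≤ b := by
    intro i
    refine le_trans ?_ hS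
    exact Finset.single_le_sum (f := fun i => (k * g i + A) / lam i)
      (fun j _ => by have := hlp j; have := hg0 j; positivity) (Finset.mem_univ i)
  have hterm' : ∀ i, k * g i + A ≤ b * lam i := fun i => (div_le_iff₀ (hlp i)).1 (hterm i)
  have hlow : ∀ i, A / b ≤ lam i := by
    intro i
    rw [div_le_iff₀ hb]
    have := hterm' i
    have := mul_nonneg hk.le (hg0 i)
    linarith
  have hE0 : 0 < E := (posDef_det_re_pos hH).trans_le hdet
  have hupp : ∀ i, lam i ≤ E * (b / A) ^ (n - 1) := by
    intro i
    have e : lam i * ∏ j ∈ Finset.univ.erase i, lam j = H.det.re := by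
      rw [det_re_eq_prod hH]
      exact Finset.mul_prod_erase _ _ (Finset.mem_univ i)
    have h1 : (A / b) ^ (n - 1) ≤ ∏ j ∈ Finset.univ.erase i, lam j := by
      have := Finset.prod_le_prod (s := Finset.univ.erase i) (f := fun _ => A / b) (g := lam)
        (fun j _ => by positivity) (fun j _ => hlow j)
      rw [Finset.prod_const, Finset.card_erase_of_mem (Finset.mem_univ i)] at this
      simpa using this
    have h2 : lam i * (A / b) ^ (n - 1) ≤ E := by
      refine le_trans ?_ (e.le.trans hdet)
      have := (hlp i).le
      gcongr
    have h3 : (b / A) ^ (n - 1) = ((A / b) ^ (n - 1))⁻¹ := by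
      rw [← inv_pow, inv_div]
    rw [h3, ← div_eq_mul_inv, le_div_iff₀ (by positivity)]
    exact h2
  have hgi : ∀ i, g i ≤ b / k * (E * (b / A) ^ (n - 1)) := by
    intro i
    have h1 : k * g i ≤ b * lam i := by linarith [hterm' i]
    have h2 : g i ≤ b / k * lam i := by
      rw [div_mul_eq_mul_div, le_div_iff₀ hk]; linarith
    refine h2.trans ?_
    have := hupp i
    gcongr
  set Q := b / k * (E * (b / A) ^ (n - 1)) with hQ
  have hQ0 : 0 ≤ Q := by positivity
  have hdecomp : L h = ∑ i, L (inner ℂ (w i) h • w i) := by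
    rw [← map_sum, w.sum_repr' h]
  have hone : ∀ i ∈ Finset.univ, (L (inner ℂ (w i) h • w i)) ^ 2 ≤ ‖h‖ ^ 2 * Q := by
    intro i _
    set c : ℂ := inner ℂ (w i) h with hc
    have hcn : ‖c‖ ≤ ‖h‖ := by
      have := norm_inner_le_norm (𝕜 := ℂ) (w i) h
      rwa [w.norm_eq_one i, one_mul] at this
    have e1 : c • w i = c.re • w i + c.im • (I • w i) := by
      conv_lhs => rw [← Complex.re_add_im c]
      rw [add_smul, mul_smul]
      simp only [Complex.coe_smul]
    rw [e1, map_add, map_smul, map_smul, smul_eq_mul, smul_eq_mul]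
    have e2 : ‖c‖ ^ 2 = c.re ^ 2 + c.im ^ 2 := by
      rw [Complex.sq_norm, Complex.normSq_apply]; ring
    have h1 : (c.re * L (w i) + c.im * L (I • w i)) ^ 2 ≤ ‖c‖ ^ 2 * g i := by
      rw [e2, hg]
      nlinarith [sq_nonneg (c.re * L (I • w i) - c.im * L (w i))]
    refine h1.trans ?_
    have := hgi i
    have := hg0 i
    gcongr
  rw [hdecomp]
  have h1 := sq_sum_le_card_mul_sum_sq (s := (Finset.univ : Finset (Fin n)))
    (f := fun i => L (inner ℂ (w i) h • w i))
  have h2 := Finset.sum_le_card_nsmul _ _ _ hone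
  simp only [Finset.card_univ, Fintype.card_fin, nsmul_eq_mul] at h1 h2
  calc _ ≤ _ := h1
    _ ≤ (n:ℝ) * (n * (‖h‖ ^ 2 * Q)) := by gcongr
    _ = _ := by ring



/-- The denominator function of the gradient quotient. -/
def EE (κ A C1 : ℝ) (u : Cn n × ℝ → ℝ) (y : Cn n) (t : ℝ) : ℝ :=
  6 - κ * (u (y, t) + C1) ^ 2 - A * ‖y‖ ^ 2

/-- The two point function for the gradient bound. -/
def PP (κ A C1 t0 M r : ℝ) (u : Cn n × ℝ → ℝ) (x y : Cn n) (t : ℝ) : ℝ :=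
  (t - t0) ^ n * (u (x, t) - u (y, t)) - M * (‖x - y‖ + r) * EE κ A C1 u y t

section
variable {Ω : Set (Cn n)} {ρ : Cn n → ℝ} {R c K T C : ℝ} {u φ : Cn n × ℝ → ℝ}
  {f : ℝ × Cn n × ℝ → ℝ} {κ A C1 t0 M r : ℝ}

lemma grad_step1 (hΩ : IsOpen Ω) (G : Good Ω T C K u φ f) {x y : Cn n}
    (hy : y ∈ Ω) {t : ℝ} (ht : t ∈ Ioo 0 T)
    (hmax : ∀ y' ∈ Ω, PP κ A C1 t0 M r u x y' t ≤ PP κ A C1 t0 M r u x y t) :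
    fderiv ℝ (fun w => u (w, t)) y (x - y) *
      ((t - t0) ^ n - M * (‖x - y‖ + r) * (2 * κ * (u (y, t) + C1))) =
    M * ‖x - y‖ * EE κ A C1 u y t + M * (‖x - y‖ + r) * (A * (2 * inner ℝ y (x - y))) := by
  set h := x - y with hh
  have hl := (Tw.line (G.u_z y hy t ht) h).1.self_of_nhds
  simp only [zero_smul, add_zero] at hl
  have hn := (Tw.normSq y h).1.self_of_nhds
  simp only [mul_zero, zero_mul, add_zero] at hn
  set d := fderiv ℝ (fun w => u (w, t)) y h with hd
  have h1 : HasDerivAt (fun s : ℝ => (t - t0) ^ n * (u (x, t) - u (y + s • h, t))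
      - M * ((1 - s) * ‖h‖ + r) * EE κ A C1 u (y + s • h) t)
      ((t - t0) ^ n * (- d) - (M * (-‖h‖) * EE κ A C1 u y t + M * (‖h‖ + r) *
        (-(κ * (2 * (u (y, t) + C1) * d)) - A * (2 * inner ℝ y h)))) 0 := by
    have a := (hl.const_sub (u (x, t))).const_mul ((t - t0) ^ n)
    have b : HasDerivAt (fun s : ℝ => M * ((1 - s) * ‖h‖ + r)) (M * (-‖h‖)) 0 := by
      have := (((((hasDerivAt_id (0:ℝ)).const_sub 1).mul_const ‖h‖).add_const r).const_mul M)
      simpa using this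
    have e : HasDerivAt (fun s : ℝ => EE κ A C1 u (y + s • h) t)
        (-(κ * (2 * (u (y, t) + C1) * d)) - A * (2 * inner ℝ y h)) 0 := by
      unfold EE
      have := ((((hl.add_const C1).fun_pow 2).const_mul κ).const_sub 6).sub (hn.const_mul A)
      refine this.congr_deriv ?_
      simp
    have := a.sub (b.mul e)
    refine this.congr_deriv ?_
    simp
  have h2 : IsLocalMax (fun s : ℝ => (t - t0) ^ n * (u (x, t) - u (y + s • h, t))
      - M * ((1 - s) * ‖h‖ + r) * EE κ A C1 u (y + s • h) t) 0 := by
    have hm := line_locmax hΩ (F := fun y' => PP κ A C1 t0 M r u x y' t) hy hmax h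
    refine hm.congr ?_
    have : Iio (1:ℝ) ∈ 𝓝 (0:ℝ) := Iio_mem_nhds one_pos
    filter_upwards [this] with s hs
    have e : ‖x - (y + s • h)‖ = (1 - s) * ‖h‖ := by
      have : x - (y + s • h) = (1 - s) • h := by rw [sub_smul, one_smul, hh]; abel
      rw [this, norm_smul, Real.norm_eq_abs, abs_of_pos (by have : s < 1 := hs; linarith)]
    simp only [PP, e]
  have h3 := h2.hasDerivAt_eq_zero h1
  linarith

lemma grad_step2 (hΩ : IsOpen Ω) (G : Good Ω T C K u φ f) {x y : Cn n}
    (hx : x ∈ Ω) (hy : y ∈ Ω) {t : ℝ} (ht : t ∈ Ioo 0 T)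
    (hmax : ∀ x' ∈ Ω, ∀ y' ∈ Ω, PP κ A C1 t0 M r u x' y' t ≤ PP κ A C1 t0 M r u x y t) (v : Cn n) :
    (t - t0) ^ n * (lv (fun w => u (w, t)) x v - lv (fun w => u (w, t)) y v)
      + M * (‖x - y‖ + r) * (2 * κ * ((fderiv ℝ (fun w => u (w, t)) y v) ^ 2
        + (fderiv ℝ (fun w => u (w, t)) y (I • v)) ^ 2)
        + 2 * κ * (u (y, t) + C1) * lv (fun w => u (w, t)) y v + 4 * A * ‖v‖ ^ 2) ≤ 0 := by
  have key : ∀ v : Cn n, (t - t0) ^ n * (D2 (fun w => u (w, t)) x v v - D2 (fun w => u (w, t)) y v v)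
      + M * (‖x - y‖ + r) * (2 * κ * (fderiv ℝ (fun w => u (w, t)) y v) ^ 2
        + 2 * κ * (u (y, t) + C1) * D2 (fun w => u (w, t)) y v v + 2 * A * ‖v‖ ^ 2) ≤ 0 := by
    intro v
    have lx := Tw.line (G.u_z x hx t ht) v
    have ly := Tw.line (G.u_z y hy t ht) v
    have tw := ((lx.sub ly).const_mul ((t - t0) ^ n)).sub
      ((((Tw.const 6).sub ((ly.add (Tw.const C1)).sq.const_mul κ)).sub
        ((Tw.normSq y v).const_mul A)).const_mul (M * (‖x - y‖ + r)))
    have hm : IsLocalMax (fun s : ℝ => PP κ A C1 t0 M r u (x + s • v) (y + s • v) t) 0 := by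
      have hl : ∀ z : Cn n, z ∈ Ω → ∀ᶠ s in 𝓝 (0 : ℝ), z + s • v ∈ Ω := fun z hz => by
        have hl : ContinuousAt (fun s : ℝ => z + s • v) 0 := by fun_prop
        exact hl.eventually_mem (by simpa using hΩ.mem_nhds hz)
      filter_upwards [hl x hx, hl y hy] with s h1 h2
      simpa using hmax _ h1 _ h2
    have hle := tw.le (by
      refine hm.congr (Eventually.of_forall fun s => ?_)
      simp only [PP, EE, add_sub_add_right_eq_sub])
    simp only [zero_smul, add_zero] at hle
    linarith
  have a := key v
  have b := key (I • v)
  have e : ‖I • v‖ = ‖v‖ := by rw [norm_smul]; simp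
  rw [e] at b
  unfold lv
  linarith

lemma grad_step3 (G : Good Ω T C K u φ f) {x y : Cn n}
    (hx : x ∈ Ω) (hy : y ∈ Ω) {t : ℝ} (ht : t ∈ Ioo 0 T) (ht0 : t0 < t)
    (hmax : ∀ s ∈ Icc t0 t, PP κ A C1 t0 M r u x y s ≤ PP κ A C1 t0 M r u x y t) :
    0 ≤ n * (t - t0) ^ (n - 1) * (u (x, t) - u (y, t)) + (t - t0) ^ n *
      ((Real.log ((cHess (fun w => u (w, t)) x).transpose.det.re) + f (t, x, u (x, t)))
       - (Real.log ((cHess (fun w => u (w, t)) y).transpose.det.re) + f (t, y, u (y, t))))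
      + M * (‖x - y‖ + r) * (2 * κ * (u (y, t) + C1)) *
       (Real.log ((cHess (fun w => u (w, t)) y).transpose.det.re) + f (t, y, u (y, t))) := by
  have hX := G.ut hx ht
  have hY := G.ut hy ht
  set ux := Real.log ((cHess (fun w => u (w, t)) x).transpose.det.re) + f (t, x, u (x, t))
  set uy := Real.log ((cHess (fun w => u (w, t)) y).transpose.det.re) + f (t, y, u (y, t))
  have hs : HasDerivAt (fun s : ℝ => (s - t0) ^ n) (n * (t - t0) ^ (n - 1)) t := by
    simpa using ((hasDerivAt_id t).sub_const t0).fun_pow n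
  have e : HasDerivAt (fun s : ℝ => EE κ A C1 u y s) (-(κ * (2 * (u (y, t) + C1) * uy))) t := by
    unfold EE
    have := ((((hY.add_const C1).fun_pow 2).const_mul κ).const_sub 6).sub_const (A * ‖y‖ ^ 2)
    refine this.congr_deriv ?_
    simp
  have h := (hs.mul (hX.sub hY)).sub (e.const_mul (M * (‖x - y‖ + r)))
  have := time_test h ht0 hmax
  simp only [Pi.sub_apply] at this
  linarith

end



section
variable {Ω : Set (Cn n)} {ρ : Cn n → ℝ} {R c K T C : ℝ} {u φ : Cn n × ℝ → ℝ}
  {f : ℝ × Cn n × ℝ → ℝ} {κ A C1 C2 t0 M r : ℝ}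

lemma EE_bounds (hR : 1 ≤ R) (hC1 : 1 ≤ C1) {y : Cn n} (hy : ‖y‖ ≤ R) {t : ℝ}
    (hb : |u (y, t)| ≤ C1) :
    4 ≤ EE (1 / (4 * C1 ^ 2)) (1 / R ^ 2) C1 u y t ∧ EE (1 / (4 * C1 ^ 2)) (1 / R ^ 2) C1 u y t ≤ 6 := by
  obtain ⟨h1, h2⟩ := abs_le.1 hb
  have a1 : 1 / (4 * C1 ^ 2) * (u (y, t) + C1) ^ 2 ≤ 1 := by
    rw [one_div, inv_mul_le_iff₀ (by positivity)]
    nlinarith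
  have a2 : 1 / R ^ 2 * ‖y‖ ^ 2 ≤ 1 := by
    rw [one_div, inv_mul_le_iff₀ (by positivity), mul_one]
    gcongr
  have a3 : 0 ≤ 1 / (4 * C1 ^ 2) * (u (y, t) + C1) ^ 2 := by positivity
  have a4 : 0 ≤ 1 / R ^ 2 * ‖y‖ ^ 2 := by positivity
  unfold EE
  constructor <;> linarith

lemma gam_bounds (hC1 : 1 ≤ C1) {w : ℝ} (hb : |w| ≤ C1) :
    0 ≤ 2 * (1 / (4 * C1 ^ 2)) * (w + C1) ∧ C1 * (2 * (1 / (4 * C1 ^ 2)) * (w + C1)) ≤ 1 := by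
  obtain ⟨h1, h2⟩ := abs_le.1 hb
  constructor
  · have : 0 ≤ w + C1 := by linarith
    positivity
  · have e : C1 * (2 * (1 / (4 * C1 ^ 2)) * (w + C1)) = (w + C1) / (2 * C1) := by field_simp; norm_num
    rw [e, div_le_one (by positivity)]
    linarith

set_option maxHeartbeats 1000000 in
lemma grad_interior (hn : 0 < n) (D : Dom Ω ρ R c K) (G : Good Ω T C K u φ f) (hT : 0 < T)
    (hC : 1 ≤ C) (hC1 : 1 ≤ C1) (hC2 : 0 < C2) (ht0 : 0 < t0) (hr : 0 < r)
    (hb : ∀ z ∈ closure Ω, ∀ t ∈ Ico 0 T, |u (z, t)| ≤ C1)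
    (hut : ∀ z ∈ Ω, ∀ t ∈ Ioo 0 T, Real.log ((cHess (fun w => u (w, t)) z).transpose.det.re)
        + f (t, z, u (z, t)) ≤ C2 / t)
    (hκ : κ = 1 / (4 * C1 ^ 2)) (hA : A = 1 / R ^ 2)
    {B N : ℝ} (hB : B = 6 * n + (K * C + C2 / t0) * T)
    (hN : N = B / (κ / 2) * (Real.exp (C2 / t0 + C) * (B / A) ^ (n - 1)))
    (hM1 : 1 ≤ M) (hM2 : C1 * T ^ n ≤ M)
    {x y : Cn n} (hx : x ∈ Ω) (hy : y ∈ Ω) (hxy : x ≠ y) {t : ℝ} (htt : t0 < t) (htT : t < T)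
    (hmax : ∀ x' ∈ Ω, ∀ y' ∈ Ω, ∀ s ∈ Icc t0 t, PP κ A C1 t0 M r u x' y' s ≤ PP κ A C1 t0 M r u x y t)
    (h0 : PP κ A C1 t0 M r u x y t = 0) : M ≤ n ^ 2 * N * T ^ n := by
  have ht : t ∈ Ioo 0 T := ⟨ht0.trans htt, htT⟩
  have htI : t ∈ Ico 0 T := ⟨ht.1.le, htT⟩
  have hR := D.hR
  have hK := D.hK
  have s1 := grad_step1 D.isOpen G hy ht (fun y' hy' => hmax x hx y' hy' t ⟨htt.le, le_rfl⟩)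
  have s2 := grad_step2 D.isOpen G hx hy ht (fun x' hx' y' hy' => hmax x' hx' y' hy' t ⟨htt.le, le_rfl⟩)
  have s3 := grad_step3 G hx hy ht htt (fun s hs => hmax x hx y hy s hs)
  have hux := hb x (subset_closure hx) t htI
  have huy := hb y (subset_closure hy) t htI
  have hE := EE_bounds (u := u) hR hC1 (D.norm_le y (subset_closure hy)) huy
  have hγ := gam_bounds hC1 huy
  rw [← hκ, ← hA] at hE
  rw [← hκ] at hγ
  unfold PP at h0
  set E := EE κ A C1 u y t with hEdef
  set γ := 2 * κ * (u (y, t) + C1) with hγdef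
  set h := x - y with hh
  have hκ0 : 0 < κ := by rw [hκ]; positivity
  have hA0 : 0 < A := by rw [hA]; positivity
  have hh0 : 0 < ‖h‖ := by rw [hh, norm_pos_iff, sub_ne_zero]; exact hxy
  set a := ‖h‖ + r with ha
  have ha0 : 0 < a := by positivity
  set τ := t - t0 with hτ
  have hτ0 : 0 < τ := by rw [hτ]; linarith
  have hτT : τ ≤ T := by rw [hτ]; linarith
  set s := τ ^ n with hs
  have hs0 : 0 < s := by positivity
  have hsT : s ≤ T ^ n := by rw [hs]; gcongr
  set δ := M * a / s with hδ
  have hM0 : 0 < M := by linarith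
  have hδ0 : 0 < δ := by positivity
  have hMa : M * a = δ * s := by rw [hδ]; field_simp
  rw [hMa] at s1 s2 s3 h0
  have hTn : 0 < T ^ n := by positivity
  -- v = δ E
  have hv : u (x, t) - u (y, t) = δ * E := by
    have : s * (u (x, t) - u (y, t)) = s * (δ * E) := by linarith
    exact mul_left_cancel₀ hs0.ne' this
  have hδC : 2 * δ ≤ C1 := by
    have h1 := (abs_le.1 hux).2
    have h2 := (abs_le.1 huy).1
    have : δ * 4 ≤ δ * E := by gcongr; exact hE.1
    linarith
  have hv6 : u (x, t) - u (y, t) ≤ 6 * δ := by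
    have : δ * E ≤ δ * 6 := by gcongr; exact hE.2
    linarith
  have hv0 : u (y, t) ≤ u (x, t) := by
    have : 0 ≤ δ * E := mul_nonneg hδ0.le (by linarith [hE.1])
    linarith
  have hδγ : δ * γ ≤ 1 / 2 := by
    have : 2 * δ * γ ≤ C1 * γ := by
      have := hγ.1
      gcongr
    linarith [hγ.2]
  have hγ1 : γ ≤ 1 := by
    have : 1 * γ ≤ C1 * γ := by
      have := hγ.1
      gcongr
    linarith [hγ.2]
  have haδ : a ≤ δ := by
    have h1 : s ≤ M := by
      have : 1 * T ^ n ≤ C1 * T ^ n := by gcongr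
      linarith
    have : s * a ≤ s * δ := by
      calc s * a ≤ M * a := by gcongr
        _ = s * δ := by rw [hMa]; ring
    exact le_of_mul_le_mul_left this hs0
  have ha2 : 2 * a ≤ 1 := by
    have h1 : C1 * s ≤ M := by
      have : C1 * s ≤ C1 * T ^ n := by gcongr
      linarith
    have h2 : C1 * s * (2 * a) ≤ C1 * s * 1 := by
      calc C1 * s * (2 * a) ≤ M * (2 * a) := by gcongr
        _ = 2 * δ * s := by linarith
        _ ≤ C1 * s := by gcongr
        _ = _ := by ring
    exact le_of_mul_le_mul_left h2 (by positivity)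
  have hhδ : ‖h‖ ≤ δ := by linarith
  -- step 1
  set L := fderiv ℝ (fun w => u (w, t)) y with hL
  have hd : M * ‖h‖ ≤ s * L h := by
    have hin : -(R * ‖h‖) ≤ inner ℝ y h := by
      have h1 := (abs_le.1 (abs_real_inner_le_norm y h)).1
      have h2 : ‖y‖ * ‖h‖ ≤ R * ‖h‖ := by
        have := D.norm_le y (subset_closure hy)
        gcongr
      linarith
    have hAR : A * R ≤ 1 := by
      rw [hA]
      have : 1 / R ^ 2 * R = 1 / R := by field_simp
      rw [this, div_le_one (by linarith)]
      exact hR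
    have h1 : -(M * ‖h‖) ≤ δ * s * (A * (2 * inner ℝ y h)) := by
      have h2 : δ * s * (A * (2 * (-(R * ‖h‖)))) ≤ δ * s * (A * (2 * inner ℝ y h)) := by gcongr
      have h3 : δ * s * (A * (2 * (-(R * ‖h‖)))) = -(2 * a * (M * ‖h‖) * (A * R)) := by
        rw [← hMa]; ring
      have h4 : 2 * a * (M * ‖h‖) * (A * R) ≤ 1 * (M * ‖h‖) * 1 := by gcongr
      linarith
    have h2 : M * ‖h‖ * 4 ≤ M * ‖h‖ * E := by gcongr; exact hE.1
    have hMh : 0 < M * ‖h‖ := by positivity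
    have h3 : M * ‖h‖ ≤ L h * (s - δ * s * γ) := by rw [s1]; linarith
    have h4 : 0 < s - δ * s * γ := by
      have : s * (δ * γ) ≤ s * (1 / 2) := by gcongr
      linarith
    have hL0 : 0 < L h := by
      by_contra! hneg
      have := mul_nonpos_of_nonpos_of_nonneg hneg h4.le
      linarith
    have h5 : 0 ≤ L h * (δ * s * γ) := by
      have := hγ.1
      positivity
    linarith
  -- step 2
  have hHx := G.pd x hx t ht
  have hHy := G.pd y hy t ht
  set g : Cn n → ℝ := fun v => (L v) ^ 2 + (L (I • v)) ^ 2 with hg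
  have hqf : ∀ v, qf (cHess (fun w => u (w, t)) x).transpose v ≤
      qf (cHess (fun w => u (w, t)) y).transpose v - δ * (κ / 2 * g v + A * ‖v‖ ^ 2) := by
    intro v
    have h1 := s2 v
    rw [G.qf hx ht, G.qf hy ht]
    have hp : 0 ≤ lv (fun w => u (w, t)) y v := by
      by_cases hv0 : v = 0
      · simp [hv0, lv, D2]
      · have := qf_pos hHy hv0
        rw [G.qf hy ht] at this
        linarith
    have h2 : 0 ≤ δ * s * (γ * lv (fun w => u (w, t)) y v) := by
      have := hγ.1
      positivity
    have h3 : s * (lv (fun w => u (w, t)) x v) ≤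
        s * (lv (fun w => u (w, t)) y v - δ * (2 * κ * g v + 4 * A * ‖v‖ ^ 2)) := by
      simp only [hg]
      linarith
    have h4 := le_of_mul_le_mul_left h3 hs0
    linarith
  set w := hHy.1.eigenvectorBasis with hw
  set lam := hHy.1.eigenvalues with hlam
  set S := ∑ i, (κ / 2 * g (w i) + A) / lam i with hS
  have hlog : Real.log ((cHess (fun w => u (w, t)) x).transpose.det.re) ≤
      Real.log ((cHess (fun w => u (w, t)) y).transpose.det.re) - δ * S := by
    have h1 := log_det_concave hHy hHx
    have h2 : ∑ i, (qf (cHess (fun w => u (w, t)) x).transpose (hHy.1.eigenvectorBasis i)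
        / hHy.1.eigenvalues i - 1) ≤ ∑ i, -(δ * ((κ / 2 * g (w i) + A) / lam i)) := by
      refine Finset.sum_le_sum fun i _ => ?_
      have h3 := hqf (w i)
      have hl : 0 < lam i := hHy.eigenvalues_pos i
      rw [hw, qf_eigen hHy i, ← hw, w.norm_eq_one i] at h3
      have h4 : qf (cHess (fun w => u (w, t)) x).transpose (w i) / lam i
          ≤ (lam i - δ * (κ / 2 * g (w i) + A * 1 ^ 2)) / lam i := by gcongr
      have h5 : (lam i - δ * (κ / 2 * g (w i) + A * 1 ^ 2)) / lam i
          = 1 - δ * ((κ / 2 * g (w i) + A) / lam i) := by field_simp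
      rw [h5] at h4
      linarith
    rw [Finset.sum_neg_distrib, ← Finset.mul_sum] at h2
    linarith
  -- step 3
  set ly := Real.log ((cHess (fun w => u (w, t)) y).transpose.det.re) with hly
  set lx := Real.log ((cHess (fun w => u (w, t)) x).transpose.det.re) with hlx
  have hy2 : ly + f (t, y, u (y, t)) ≤ C2 / t0 := by
    refine (hut y hy t ht).trans ?_
    gcongr
  have hfd : f (t, x, u (x, t)) - f (t, y, u (y, t)) ≤ K * C * δ := by
    have h1 := G.f_anti t ht x hx _ _ hv0
    have h2 := (abs_le.1 (G.f_lip t ht x hx y hy (u (y, t)))).2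
    have h3 : K * C * ‖x - y‖ ≤ K * C * δ := by gcongr
    linarith
  have hSB : S ≤ B / τ := by
    have e1 : s = τ * τ ^ (n - 1) := by
      rw [hs, ← pow_succ']
      congr 1
      omega
    have e2 : (n:ℝ) * τ ^ (n - 1) = s * (n / τ) := by rw [e1]; field_simp
    rw [e2] at s3
    have s4 : 0 ≤ s * (n / τ * (u (x, t) - u (y, t)) + ((lx + f (t, x, u (x, t))) - (ly + f (t, y, u (y, t))))
        + δ * γ * (ly + f (t, y, u (y, t)))) := by linarith
    have s5 := nonneg_of_mul_nonneg_right s4 hs0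
    have h1 : n / τ * (u (x, t) - u (y, t)) ≤ n / τ * (6 * δ) := by gcongr
    have h2 : δ * γ * (ly + f (t, y, u (y, t))) ≤ δ * (C2 / t0) := by
      have h3 : δ * γ * (ly + f (t, y, u (y, t))) ≤ δ * γ * (C2 / t0) := by
        have := hγ.1
        gcongr
      have h4 : δ * γ * (C2 / t0) ≤ δ * 1 * (C2 / t0) := by gcongr
      linarith
    have h3 : δ * S ≤ δ * (6 * (n / τ) + K * C + C2 / t0) := by linarith
    have h4 := le_of_mul_le_mul_left h3 hδ0
    refine h4.trans ?_
    rw [hB, le_div_iff₀ hτ0]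
    have e3 : (6 * (n / τ) + K * C + C2 / t0) * τ = 6 * n + (K * C + C2 / t0) * τ := by field_simp; ring
    rw [e3]
    gcongr
  have hn1 : (1:ℝ) ≤ n := by exact_mod_cast hn
  have hB0 : 0 < B := by rw [hB]; positivity
  have hdet : (cHess (fun w => u (w, t)) y).transpose.det.re ≤ Real.exp (C2 / t0 + C) := by
    rw [← Real.log_le_iff_le_exp (posDef_det_re_pos hHy)]
    have := (abs_le.1 (G.f_abs t ht y hy (u (y, t)))).1
    linarith
  have hfin := lin_alg_bound hHy L (by positivity : 0 < κ / 2) hA0 (by positivity : 0 < B / τ) hdet hSB h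
  have hNe : B / τ / (κ / 2) * (Real.exp (C2 / t0 + C) * (B / τ / A) ^ (n - 1)) = N / s := by
    have e1 : s = τ * τ ^ (n - 1) := by
      rw [hs, ← pow_succ']
      congr 1
      omega
    have e2 : (B / τ / A) ^ (n - 1) = (B / A) ^ (n - 1) / τ ^ (n - 1) := by
      rw [← div_pow]; congr 1; field_simp
    rw [hN, e1, e2]
    field_simp
  rw [hNe] at hfin
  have hN0 : 0 < N := by rw [hN]; positivity
  have h1 : (M * ‖h‖) ^ 2 ≤ (s * L h) ^ 2 := by gcongr
  have h2 : (s * L h) ^ 2 ≤ ‖h‖ ^ 2 * (n ^ 2 * N * s) := by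
    calc (s * L h) ^ 2 = s ^ 2 * (L h) ^ 2 := by ring
      _ ≤ s ^ 2 * (n ^ 2 * ‖h‖ ^ 2 * (N / s)) := by gcongr
      _ = _ := by field_simp
  have h3 : ‖h‖ ^ 2 * M ^ 2 ≤ ‖h‖ ^ 2 * (n ^ 2 * N * s) := by
    rw [← mul_pow, mul_comm ‖h‖ M]; exact h1.trans h2
  have h4 := le_of_mul_le_mul_left h3 (by positivity)
  have h5 : n ^ 2 * N * s ≤ n ^ 2 * N * T ^ n := by gcongr
  nlinarith

end



section
variable {Ω : Set (Cn n)} {ρ : Cn n → ℝ} {R c K T C : ℝ} {u φ : Cn n × ℝ → ℝ}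
  {f : ℝ × Cn n × ℝ → ℝ} {κ A C1 C2 t0 M r : ℝ}

lemma grad_global (hn : 0 < n) (D : Dom Ω ρ R c K) (G : Good Ω T C K u φ f) (hT : 0 < T)
    (hC : 1 ≤ C) (hC1 : 1 ≤ C1) (hC2 : 0 < C2) (ht0 : 0 < t0) (hr : 0 < r)
    (hb : ∀ z ∈ closure Ω, ∀ t ∈ Ico 0 T, |u (z, t)| ≤ C1)
    (hut : ∀ z ∈ Ω, ∀ t ∈ Ioo 0 T, Real.log ((cHess (fun w => u (w, t)) z).transpose.det.re)
        + f (t, z, u (z, t)) ≤ C2 / t)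
    {CB : ℝ} (hCB : 0 < CB)
    (hbd : ∀ t ∈ Ico t0 T, ∀ x ∈ closure Ω, ∀ y ∈ closure Ω, (x ∉ Ω ∨ y ∉ Ω) →
        u (x, t) - u (y, t) ≤ CB * ‖x - y‖)
    (hκ : κ = 1 / (4 * C1 ^ 2)) (hA : A = 1 / R ^ 2)
    {B N M0 : ℝ} (hB : B = 6 * n + (K * C + C2 / t0) * T)
    (hN : N = B / (κ / 2) * (Real.exp (C2 / t0 + C) * (B / A) ^ (n - 1)))
    (hN0 : 0 ≤ N)
    (hM0 : M0 = 1 + T ^ n * (C1 + CB) + n ^ 2 * N * T ^ n)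
    {T' : ℝ} (hT' : T' < T)
    {x y : Cn n} (hx : x ∈ closure Ω) (hy : y ∈ closure Ω) {t : ℝ} (ht : t ∈ Icc t0 T') :
    (t - t0) ^ n * (u (x, t) - u (y, t)) ≤ 6 * M0 * (‖x - y‖ + r) := by
  set P : Set (Cn n × Cn n × ℝ) := closure Ω ×ˢ closure Ω ×ˢ Icc t0 T' with hP
  set Q : Cn n × Cn n × ℝ → ℝ := fun p =>
    (p.2.2 - t0) ^ n * (u (p.1, p.2.2) - u (p.2.1, p.2.2)) /
      ((‖p.1 - p.2.1‖ + r) * EE κ A C1 u p.2.1 p.2.2) with hQ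
  have hmem : ∀ s ∈ Icc t0 T', s ∈ Ico 0 T := fun s hs => ⟨ht0.le.trans hs.1, hs.2.trans_lt hT'⟩
  have hE : ∀ z ∈ closure Ω, ∀ s ∈ Icc t0 T', 4 ≤ EE κ A C1 u z s ∧ EE κ A C1 u z s ≤ 6 := by
    intro z hz s hs
    rw [hκ, hA]
    exact EE_bounds D.hR hC1 (D.norm_le z hz) (hb z hz s (hmem s hs))
  have hden : ∀ p ∈ P, 0 < (‖p.1 - p.2.1‖ + r) * EE κ A C1 u p.2.1 p.2.2 := by
    rintro ⟨a, b, s⟩ ⟨ha, hb', hs⟩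
    have := (hE b hb' s hs).1
    exact mul_pos (by positivity) (by simp only; linarith)
  have hQc : ContinuousOn Q P := by
    have c1 : ContinuousOn (fun p : Cn n × Cn n × ℝ => u (p.1, p.2.2)) P :=
      G.u_cont.comp (f := fun p : Cn n × Cn n × ℝ => (p.1, p.2.2)) (by fun_prop)
        fun p hp => ⟨hp.1, hmem _ hp.2.2⟩
    have c2 : ContinuousOn (fun p : Cn n × Cn n × ℝ => u (p.2.1, p.2.2)) P :=
      G.u_cont.comp (f := fun p : Cn n × Cn n × ℝ => (p.2.1, p.2.2)) (by fun_prop)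
        fun p hp => ⟨hp.2.1, hmem _ hp.2.2⟩
    refine ContinuousOn.div ?_ ?_ fun p hp => (hden p hp).ne'
    · exact ContinuousOn.mul (by fun_prop) (c1.sub c2)
    · unfold EE
      refine ContinuousOn.mul (by fun_prop) ?_
      exact ((continuousOn_const.sub (continuousOn_const.mul ((c2.add continuousOn_const).pow 2))).sub
        (by fun_prop))
  have hxyt : (x, y, t) ∈ P := ⟨hx, hy, ht⟩
  obtain ⟨⟨x1, y1, t1⟩, hp1, hmax⟩ := (D.compact.prod (D.compact.prod isCompact_Icc)).exists_isMaxOn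
    ⟨(x, y, t), hxyt⟩ hQc
  set M := Q (x1, y1, t1) with hM
  have hM0pos : 1 ≤ M0 := by rw [hM0]; have : 0 ≤ T ^ n * (C1 + CB) + n ^ 2 * N * T ^ n := by positivity
                             linarith
  suffices hMM : M ≤ M0 by
    have h1 : Q (x, y, t) ≤ M0 := (hmax hxyt).trans hMM
    have h2 := hden _ hxyt
    simp only [hQ] at h1 h2
    rw [div_le_iff₀ h2] at h1
    refine h1.trans ?_
    have h3 := (hE y hy t ht).2
    have : M0 * ((‖x - y‖ + r) * EE κ A C1 u y t) ≤ M0 * ((‖x - y‖ + r) * 6) := by gcongr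
    linarith
  by_contra! hlt
  obtain ⟨hx1, hy1, ht1⟩ := hp1
  simp only at hx1 hy1 ht1
  have hden1 := hden (x1, y1, t1) ⟨hx1, hy1, ht1⟩
  simp only at hden1
  have hM1 : 1 ≤ M := by linarith
  have hTn : 0 < T ^ n := by positivity
  have hnN : 0 ≤ n ^ 2 * N * T ^ n := by positivity
  have heq : (t1 - t0) ^ n * (u (x1, t1) - u (y1, t1)) = M * ((‖x1 - y1‖ + r) * EE κ A C1 u y1 t1) := by
    rw [hM, hQ]; simp only; rw [div_mul_cancel₀ _ hden1.ne']
  have hpos : 0 < (t1 - t0) ^ n * (u (x1, t1) - u (y1, t1)) := by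
    rw [heq]; exact mul_pos (by linarith) hden1
  have htt : t0 < t1 := by
    rcases ht1.1.eq_or_lt with h | h
    · rw [← h, sub_self, zero_pow hn.ne', zero_mul] at hpos
      exact absurd hpos (lt_irrefl _)
    · exact h
  have hne : x1 ≠ y1 := by
    rintro rfl
    simp at hpos
  have hs0 : 0 < (t1 - t0) ^ n := by have : 0 < t1 - t0 := by linarith
                                     positivity
  have hsT : (t1 - t0) ^ n ≤ T ^ n := by
    have h1 : 0 ≤ t1 - t0 := by linarith
    have h2 : t1 - t0 ≤ T := by linarith [ht1.2]
    gcongr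
  have hboth : x1 ∈ Ω ∧ y1 ∈ Ω := by
    by_contra hcon
    have hor : x1 ∉ Ω ∨ y1 ∉ Ω := by tauto
    have h1 := hbd t1 ⟨ht1.1, ht1.2.trans_lt hT'⟩ x1 hx1 y1 hy1 hor
    have h2 : (t1 - t0) ^ n * (u (x1, t1) - u (y1, t1)) ≤ T ^ n * (CB * ‖x1 - y1‖) := by
      have : (t1 - t0) ^ n * (u (x1, t1) - u (y1, t1)) ≤ (t1 - t0) ^ n * (CB * ‖x1 - y1‖) := by gcongr
      refine this.trans ?_
      gcongr
    rw [heq] at h2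
    have h3 := (hE y1 hy1 t1 ht1).1
    have h4 : M * ((‖x1 - y1‖ + r) * 1) ≤ M * ((‖x1 - y1‖ + r) * EE κ A C1 u y1 t1) := by
      gcongr; linarith
    have hnp : 0 < ‖x1 - y1‖ := by rw [norm_pos_iff, sub_ne_zero]; exact hne
    have h5 : M * ‖x1 - y1‖ ≤ (T ^ n * CB) * ‖x1 - y1‖ := by
      have : 0 ≤ M * r := by positivity
      linarith
    have h6 := le_of_mul_le_mul_right h5 hnp
    have : 0 ≤ T ^ n * C1 := by positivity
    linarith
  have hPP : ∀ a ∈ closure Ω, ∀ b ∈ closure Ω, ∀ s ∈ Icc t0 T', PP κ A C1 t0 M r u a b s ≤ 0 := by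
    intro a ha b hb' s hs
    have hp : (a, b, s) ∈ P := ⟨ha, hb', hs⟩
    have h1 : Q (a, b, s) ≤ M := hmax hp
    have h2 := hden _ hp
    simp only [hQ] at h1 h2
    rw [div_le_iff₀ h2] at h1
    unfold PP
    linarith
  have h0 : PP κ A C1 t0 M r u x1 y1 t1 = 0 := by
    unfold PP; rw [heq]; ring
  have := grad_interior hn D G hT hC hC1 hC2 ht0 hr hb hut hκ hA hB hN hM1
    (by have : 0 ≤ T ^ n * CB := by positivity
        linarith) hboth.1 hboth.2 hne htt (ht1.2.trans_lt hT')
    (fun x' hx' y' hy' s hs => by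
      rw [h0]
      exact hPP x' (subset_closure hx') y' (subset_closure hy') s ⟨hs.1, hs.2.trans ht1.2⟩) h0
  have h7 : 0 ≤ T ^ n * (C1 + CB) := by positivity
  linarith

end

/-- **Interior gradient estimate** (Proposition 2.3): under the a priori hypotheses, for
`m > 2/T` and `2/m < ε < T` there is `C₄ > 0` depending only on `Ω, m, ε, T, Cu, Cφv, Cf`
such that `|∇u| ≤ C₄` on `Ω×(ε,T)`. -/
theorem stmt_9 (n : ℕ) (Ω : Set (Cn n)) (T Cu Cφv Cf m ε : ℝ)
    (hΩ : IsSPCDomain Ω) (hT : 0 < T) (hm : 2 / T < m) (hε : 2 / m < ε) (hεT : ε < T) :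
    ∃ C₄ : ℝ, 0 < C₄ ∧
      ∀ (u φ : Cn n × ℝ → ℝ) (f : ℝ × Cn n × ℝ → ℝ),
        AprioriHyps n Ω T Cu Cφv Cf u φ f →
        ∀ z ∈ Ω, ∀ t ∈ Ioo ε T, ‖fderiv ℝ (fun w => u (w, t)) z‖ ≤ C₄ := by
  have hm0 : 0 < m := lt_trans (by positivity) hm
  have hε0 : 0 < ε := lt_trans (by positivity) hε
  rcases Nat.eq_zero_or_pos n with hn | hn
  · subst hn
    refine ⟨1, one_pos, fun u φ f _ z _ t _ => ?_⟩
    have : fderiv ℝ (fun w => u (w, t)) z = 0 := by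
      ext v
      rw [Subsingleton.elim v 0]
      simp
    rw [this, norm_zero]
    exact zero_le_one
  obtain ⟨ρ, R, c, K, D⟩ := dom_exists hΩ
  set C := 1 + |Cu| + |Cφv| + |Cf| with hC
  have hC1' : 1 ≤ C := by rw [hC]; linarith [abs_nonneg Cu, abs_nonneg Cφv, abs_nonneg Cf]
  have hCu : Cu ≤ C := by rw [hC]; linarith [le_abs_self Cu, abs_nonneg Cφv, abs_nonneg Cf]
  have hCp : Cφv ≤ C := by rw [hC]; linarith [abs_nonneg Cu, le_abs_self Cφv, abs_nonneg Cf]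
  have hCf : Cf ≤ C := by rw [hC]; linarith [abs_nonneg Cu, abs_nonneg Cφv, le_abs_self Cf]
  obtain ⟨C1, hC1, b1⟩ := bound_u hn D hT hC1'
  obtain ⟨C2, hC2, b2⟩ := bound_ut D hT hC1' hC1
  have ht0 : 0 < ε / 2 := by positivity
  obtain ⟨CB, hCB, b3⟩ := bound_bdry (T := T) hn D hC1' hC2 ht0
  have hR := D.hR
  have hK := D.hK
  set κ := 1 / (4 * C1 ^ 2) with hκ
  set A := 1 / R ^ 2 with hA
  set B := 6 * n + (K * C + C2 / (ε / 2)) * T with hB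
  have hB0 : 0 < B := by positivity
  set N := B / (κ / 2) * (Real.exp (C2 / (ε / 2) + C) * (B / A) ^ (n - 1)) with hN
  have hN0 : 0 ≤ N := by positivity
  set M0 := 1 + T ^ n * (C1 + CB) + n ^ 2 * N * T ^ n with hM0
  have hM0p : 0 < M0 := by positivity
  refine ⟨6 * M0 / (ε / 2) ^ n, by positivity, ?_⟩
  intro u φ f hyp z hz t ht
  have G := aprioriHyps_good D hT hC1' hCu hCp hCf hyp
  have hb := b1 u φ f G
  have hut := b2 u φ f G hb
  have hbd := b3 u φ f G hut
  have hlip : ∀ x ∈ closure Ω, ∀ y ∈ closure Ω,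
      u (x, t) - u (y, t) ≤ 6 * M0 / (ε / 2) ^ n * ‖x - y‖ := by
    intro x hx y hy
    have h1 : (t - ε / 2) ^ n * (u (x, t) - u (y, t)) ≤ 6 * M0 * ‖x - y‖ := by
      refine le_of_forall_pos_le_add fun e he => ?_
      have := grad_global hn D G hT hC1' hC1 hC2 ht0 (r := e / (6 * M0)) (by positivity) hb hut hCB hbd
        hκ hA hB hN hN0 hM0 ht.2 hx hy (t := t) ⟨by linarith [ht.1], le_rfl⟩
      refine this.trans (le_of_eq ?_)
      field_simp
    have h3 : (ε / 2) ^ n ≤ (t - ε / 2) ^ n := by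
      have : ε / 2 ≤ t - ε / 2 := by linarith [ht.1]
      gcongr
    rw [div_mul_eq_mul_div, le_div_iff₀ (by positivity)]
    rcases le_total (u (x, t) - u (y, t)) 0 with h | h
    · have h4 : (u (x, t) - u (y, t)) * (ε / 2) ^ n ≤ 0 :=
        mul_nonpos_of_nonpos_of_nonneg h (by positivity)
      have : 0 ≤ 6 * M0 * ‖x - y‖ := by positivity
      linarith
    · have : (ε / 2) ^ n * (u (x, t) - u (y, t)) ≤ (t - ε / 2) ^ n * (u (x, t) - u (y, t)) := by gcongr
      linarith
  refine norm_fderiv_le_of_lip' ℝ (by positivity) ?_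
  filter_upwards [D.isOpen.mem_nhds hz] with x hx
  rw [Real.norm_eq_abs, abs_le]
  have h1 := hlip x (subset_closure hx) z (subset_closure hz)
  have h2 := hlip z (subset_closure hz) x (subset_closure hx)
  rw [norm_sub_rev z x] at h2
  constructor <;> linarith
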